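/- Let 𝒲, 𝒲̂, 𝒳, 𝒴, 𝒵, 𝓑 be finite sets with |𝓑| ≥ 2, P_W, P_Ŵ distributions on 𝒲, 𝒲̂, and π_{XYZ} a distribution on 𝒳×𝒴×𝒵 such that there exists a pair (y,z) with π_{YZ|X}(y,z|x) > 0 for every x with π_X(x) > 0. Let Γ(π_{XYZ}, P_W P_Ŵ) be the limit as n→∞ of (1/n) times the infimum over all broadcast sequential codes of blocklength n of D(P_{Y^n Z^n|X^n} ‖ π_{YZ|X}^n | π_X^n). Then Γ(π_{XYZ}, P_W P_Ŵ) ≤ Δ̂(π_{XYZ}, P_W P_Ŵ), where Δ̂ is the minimum, over finite auxiliary alphabets 𝒰, 𝒰̂, 𝒱 and distributions P_{UÛV}, P_{B|XUÛV}, P_{Y|BUÛV}, P_{Z|BUV} satisfying both H(U|V) + I(B; Û | XYZUV) ≤ H(W) + H(BU|XYZV) and H(UÛ|V) ≤ H(Ŵ) + H(W) + H(BUÛ|XYZV), of D(P_{YZ|XV} ‖ π_{YZ|X} | π_X P_V), with all entropies and mutual informations evaluated under the joint distribution π_X P_{UÛV} P_{B|XUÛV} P_{Y|BUÛV} P_{Z|BUV}.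 -/

import Mathlib

open scoped BigOperators ENNReal
open Classical

noncomputable section

/-- `p` is a probability mass function on the finite type `α`. -/
def IsDist {α : Type} [Fintype α] (p : α → ℝ) : Prop :=
  (∀ a, 0 ≤ p a) ∧ (∑ a, p a) = 1

/-- `k` is a conditional probability kernel. -/
def IsKernel {α β : Type} [Fintype β] (k : α → β → ℝ) : Prop :=
  ∀ a, (∀ b, 0 ≤ k a b) ∧ (∑ b, k a b) = 1

/-- Marginal (pushforward) of `p` along the map `f`. -/
def marg {α β : Type} [Fintype α] (f : α → β) (p : α → ℝ) : β → ℝ :=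
  fun b => ∑ a, if f a = b then p a else 0

/-- Shannon entropy (natural log). -/
def ent {α : Type} [Fintype α] (p : α → ℝ) : ℝ :=
  ∑ a, Real.negMulLog (p a)

/-- Conditional entropy `H(f(A) | g(A))` for `A ∼ p`. -/
def condEnt {α β γ : Type} [Fintype α] [Fintype β] [Fintype γ]
    (f : α → β) (g : α → γ) (p : α → ℝ) : ℝ :=
  ent (marg (fun a => (f a, g a)) p) - ent (marg g p)

/-- Kullback–Leibler divergence `D(p‖q)` with value `⊤` if `p` is not absolutely
continuous with respect to `q`. -/
def KL {α : Type} [Fintype α] (p q : α → ℝ) : ℝ≥0∞ :=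
  if ∀ a, q a = 0 → p a = 0 then ENNReal.ofReal (∑ a, p a * Real.log (p a / q a)) else ⊤


/-- Conditional mutual information `I(f(A); g(A) | h(A))` for `A ∼ p`. -/
def condMI {α β γ δ : Type} [Fintype α] [Fintype β] [Fintype γ] [Fintype δ]
    (f : α → β) (g : α → γ) (h : α → δ) (p : α → ℝ) : ℝ :=
  condEnt f h p + condEnt g h p - condEnt (fun a => (f a, g a)) h p

/-- The joint distribution `π_X P_{UÛV} P_{B|XUÛV} P_{Y|BUÛV} P_{Z|BUV}`
on `X × U × Û × V × B × Y × Z`. -/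
def bJoint {X Y Z B U Uh V : Type} (πX : X → ℝ) (PUUV : U × Uh × V → ℝ)
    (PB : X × U × Uh × V → B → ℝ) (PY : B × U × Uh × V → Y → ℝ)
    (PZ : B × U × V → Z → ℝ) : X × U × Uh × V × B × Y × Z → ℝ :=
  fun q => πX q.1 * PUUV (q.2.1, q.2.2.1, q.2.2.2.1) *
    PB (q.1, q.2.1, q.2.2.1, q.2.2.2.1) q.2.2.2.2.1 *
    PY (q.2.2.2.2.1, q.2.1, q.2.2.1, q.2.2.2.1) q.2.2.2.2.2.1 *
    PZ (q.2.2.2.2.1, q.2.1, q.2.2.2.1) q.2.2.2.2.2.2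

/-- Feasible values of `D(P_{YZ|XV} ‖ π_{YZ|X} | π_X P_V)` for the broadcast lower
bound `Δ(π_{XYZ}, P_W P_Ŵ)`: the constraints are `H(U|V) ≤ h_W + H(BU|XYZV)` and
`H(UÛ|V) ≤ h_Ŵ + h_W + H(BUÛ|XYZV)`.  If `extra = true`, the term
`I(B;Û|XYZUV)` is added to the left side of the first constraint (giving `Δ̂`). -/
def bDeltaSet (X Y Z B : Type) [Fintype X] [Fintype Y] [Fintype Z] [Fintype B]
    (π : X × Y × Z → ℝ) (hW hWh : ℝ) (extra : Bool) : Set ℝ≥0∞ :=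
  { d | ∃ (m mh l : ℕ) (PUUV : Fin m × Fin mh × Fin l → ℝ)
      (PB : X × Fin m × Fin mh × Fin l → B → ℝ)
      (PY : B × Fin m × Fin mh × Fin l → Y → ℝ)
      (PZ : B × Fin m × Fin l → Z → ℝ),
      IsDist PUUV ∧ IsKernel PB ∧ IsKernel PY ∧ IsKernel PZ ∧
      (condEnt (fun q : X × Fin m × Fin mh × Fin l × B × Y × Z => q.2.1)
          (fun q => q.2.2.2.1)
          (bJoint (marg (fun p : X × Y × Z => p.1) π) PUUV PB PY PZ) +
        (if extra then
          condMI (fun q : X × Fin m × Fin mh × Fin l × B × Y × Z => q.2.2.2.2.1)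
            (fun q => q.2.2.1)
            (fun q => (q.1, q.2.2.2.2.2.1, q.2.2.2.2.2.2, q.2.1, q.2.2.2.1))
            (bJoint (marg (fun p : X × Y × Z => p.1) π) PUUV PB PY PZ)
        else 0) ≤
        hW + condEnt (fun q : X × Fin m × Fin mh × Fin l × B × Y × Z =>
            (q.2.2.2.2.1, q.2.1))
          (fun q => (q.1, q.2.2.2.2.2.1, q.2.2.2.2.2.2, q.2.2.2.1))
          (bJoint (marg (fun p : X × Y × Z => p.1) π) PUUV PB PY PZ)) ∧
      condEnt (fun q : X × Fin m × Fin mh × Fin l × B × Y × Z => (q.2.1, q.2.2.1))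
          (fun q => q.2.2.2.1)
          (bJoint (marg (fun p : X × Y × Z => p.1) π) PUUV PB PY PZ) ≤
        hWh + hW +
          condEnt (fun q : X × Fin m × Fin mh × Fin l × B × Y × Z =>
              (q.2.2.2.2.1, q.2.1, q.2.2.1))
            (fun q => (q.1, q.2.2.2.2.2.1, q.2.2.2.2.2.2, q.2.2.2.1))
            (bJoint (marg (fun p : X × Y × Z => p.1) π) PUUV PB PY PZ) ∧
      d = KL
          (marg (fun q : X × Fin m × Fin mh × Fin l × B × Y × Z =>
              (q.1, q.2.2.2.1, q.2.2.2.2.2.1, q.2.2.2.2.2.2))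
            (bJoint (marg (fun p : X × Y × Z => p.1) π) PUUV PB PY PZ))
          (fun r : X × Fin l × Y × Z =>
            marg (fun p : Fin m × Fin mh × Fin l => p.2.2) PUUV r.2.1 *
              π (r.1, r.2.2.1, r.2.2.2)) }

/-- A broadcast sequential code of blocklength `n`. -/
structure BCode (W Wh X Y Z B : Type) [Fintype W] [Fintype Wh] [Fintype X]
    [Fintype Y] [Fintype Z] [Fintype B] (n : ℕ) where
  enc : Fin n → (Fin n → W) → (Fin n → Wh) → (Fin n → X) → (Fin n → B) → B → ℝ
  decY : Fin n → (Fin n → W) → (Fin n → Wh) → (Fin n → B) → (Fin n → Y) → Y → ℝ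
  decZ : Fin n → (Fin n → W) → (Fin n → B) → (Fin n → Z) → Z → ℝ
  enc_dist : ∀ k w wh x b, IsDist (enc k w wh x b)
  decY_dist : ∀ k w wh b y, IsDist (decY k w wh b y)
  decZ_dist : ∀ k w b z, IsDist (decZ k w b z)
  enc_causal : ∀ k w w' wh wh' x x' b b',
    (∀ i, i ≤ k → w i = w' i) → (∀ i, i ≤ k → wh i = wh' i) →
    (∀ i, i ≤ k → x i = x' i) → (∀ i, i < k → b i = b' i) →
    enc k w wh x b = enc k w' wh' x' b'
  decY_causal : ∀ k w w' wh wh' b b' y y',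
    (∀ i, i ≤ k → w i = w' i) → (∀ i, i ≤ k → wh i = wh' i) →
    (∀ i, i ≤ k → b i = b' i) → (∀ i, i < k → y i = y' i) →
    decY k w wh b y = decY k w' wh' b' y'
  decZ_causal : ∀ k w w' b b' z z',
    (∀ i, i ≤ k → w i = w' i) → (∀ i, i ≤ k → b i = b' i) →
    (∀ i, i < k → z i = z' i) →
    decZ k w b z = decZ k w' b' z'

/-- The broadcast channel `P_{Y^n Z^n|X^n}` synthesized by a broadcast code. -/
def BCode.channel {W Wh X Y Z B : Type} [Fintype W] [Fintype Wh] [Fintype X]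
    [Fintype Y] [Fintype Z] [Fintype B] {n : ℕ} (C : BCode W Wh X Y Z B n)
    (PW : W → ℝ) (PWh : Wh → ℝ)
    (x : Fin n → X) (y : Fin n → Y) (z : Fin n → Z) : ℝ :=
  ∑ w : Fin n → W, ∑ wh : Fin n → Wh, ∑ b : Fin n → B,
    (∏ k, PW (w k)) * (∏ k, PWh (wh k)) * (∏ k, C.enc k w wh x b (b k)) *
      (∏ k, C.decY k w wh b y (y k)) * (∏ k, C.decZ k w b z (z k))

/-- Least divergence over broadcast sequential codes of blocklength `n`. -/
def BGammaN (W Wh X Y Z B : Type) [Fintype W] [Fintype Wh] [Fintype X]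
    [Fintype Y] [Fintype Z] [Fintype B]
    (PW : W → ℝ) (PWh : Wh → ℝ) (π : X × Y × Z → ℝ) (n : ℕ) : ℝ≥0∞ :=
  sInf { d | ∃ C : BCode W Wh X Y Z B n,
    d = KL
      (fun p : (Fin n → X) × (Fin n → Y) × (Fin n → Z) =>
        (∏ i, marg (fun q : X × Y × Z => q.1) π (p.1 i)) *
          C.channel PW PWh p.1 p.2.1 p.2.2)
      (fun p : (Fin n → X) × (Fin n → Y) × (Fin n → Z) =>
        ∏ i, π (p.1 i, p.2.1 i, p.2.2 i)) }

section RandomFunctions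

/-- The indicator of `a = b`, as a real number. -/
def ind {α : Type} (a b : α) : ℝ := if a = b then 1 else 0

lemma ind_nonneg {α : Type} (a b : α) : 0 ≤ ind a b := by unfold ind; split_ifs <;> norm_num

lemma ind_mul_self {α : Type} (a b : α) : ind a b * ind a b = ind a b := by
  unfold ind; split_ifs <;> norm_num

variable {ι α : Type} [Fintype ι] [DecidableEq ι]

lemma sum_mul_ind {α : Type} [Fintype α] (f : α → ℝ) (a : α) : ∑ b, f b * ind b a = f a := by
  simp [ind]

/-- The weight of a function whose values are drawn independently from `w i`. -/
def funWeight {ι α : Type} [Fintype ι] (w : ι → α → ℝ) (f : ι → α) : ℝ := ∏ i, w i (f i)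

lemma funWeight_nonneg {ι α : Type} [Fintype ι] {w : ι → α → ℝ} (hw : ∀ i a, 0 ≤ w i a)
    (f : ι → α) : 0 ≤ funWeight w f := Finset.prod_nonneg fun i _ => hw i _

variable [Fintype α]

lemma sum_funWeight_mul_prod (w h : ι → α → ℝ) :
    ∑ f, funWeight w f * ∏ i, h i (f i) = ∏ i, ∑ a, w i a * h i a := by
  simp only [funWeight, ← Finset.prod_mul_distrib]
  rw [Fintype.prod_sum]

lemma sum_funWeight {w : ι → α → ℝ} (hw : ∀ i, ∑ a, w i a = 1) :
    ∑ f, funWeight w f = 1 := by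
  simpa [hw] using sum_funWeight_mul_prod w (fun _ _ => 1)

lemma sum_funWeight_ind {w : ι → α → ℝ} (hw : ∀ i, ∑ a, w i a = 1) (i : ι) (a : α) :
    ∑ f, funWeight w f * ind (f i) a = w i a := by
  have h := sum_funWeight_mul_prod w (fun j b => if j = i then ind b a else 1)
  have h1 : ∀ f : ι → α, ∏ j, (if j = i then ind (f j) a else 1) = ind (f i) a := fun f => by
    rw [Finset.prod_ite_eq' Finset.univ i (fun j => ind (f j) a)]; simp
  have h2 : ∀ j, ∑ b, w j b * (if j = i then ind b a else 1) = if j = i then w j a else 1 := by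
    intro j
    split_ifs with hj
    · exact sum_mul_ind _ _
    · simp [hw]
  simp only [h1, h2] at h
  rw [h, Finset.prod_ite_eq' Finset.univ i (fun j => w j a)]; simp

lemma sum_funWeight_ind_ind {w : ι → α → ℝ} (hw : ∀ i, ∑ a, w i a = 1) {i i' : ι}
    (hne : i ≠ i') (a : α) :
    ∑ f, funWeight w f * (ind (f i) a * ind (f i') a) = w i a * w i' a := by
  have h := sum_funWeight_mul_prod w
    (fun j b => (if j = i then ind b a else 1) * (if j = i' then ind b a else 1))
  have h1 : ∀ f : ι → α, ∏ j, ((if j = i then ind (f j) a else 1) *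
      (if j = i' then ind (f j) a else 1)) = ind (f i) a * ind (f i') a := fun f => by
    rw [Finset.prod_mul_distrib, Finset.prod_ite_eq' Finset.univ i (fun j => ind (f j) a),
      Finset.prod_ite_eq' Finset.univ i' (fun j => ind (f j) a)]; simp
  have h2 : ∀ j, ∑ b, w j b * ((if j = i then ind b a else 1) *
      (if j = i' then ind b a else 1)) =
      (if j = i then w j a else 1) * (if j = i' then w j a else 1) := by
    intro j
    by_cases hj : j = i
    · have hj' : j ≠ i' := fun h => hne (hj.symm.trans h)
      simp [hj, hne, sum_mul_ind]
    · by_cases hj' : j = i'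
      · simp [hj', hne.symm, sum_mul_ind]
      · simp [hj, hj', hw]
  simp only [h1, h2] at h
  rw [h, Finset.prod_mul_distrib, Finset.prod_ite_eq' Finset.univ i (fun j => w j a),
    Finset.prod_ite_eq' Finset.univ i' (fun j => w j a)]; simp

/-- Cauchy–Schwarz for a finite probability weight. -/
lemma sum_weight_abs_le {Ω : Type} [Fintype Ω] {μ Z : Ω → ℝ} (hμ : ∀ o, 0 ≤ μ o)
    (h1 : ∑ o, μ o = 1) {c : ℝ} (hc : 0 ≤ c) (hZ : ∑ o, μ o * Z o ^ 2 ≤ c ^ 2) :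
    ∑ o, μ o * |Z o| ≤ c := by
  have := Finset.sum_sq_le_sum_mul_sum_of_sq_le_mul Finset.univ
    (r := fun o => μ o * |Z o|) (f := μ) (g := fun o => μ o * Z o ^ 2)
    (fun o _ => hμ o) (fun o _ => mul_nonneg (hμ o) (sq_nonneg _))
    (fun o _ => by rw [mul_pow, sq_abs]; apply le_of_eq; ring)
  rw [h1, one_mul] at this
  exact abs_le_of_sq_le_sq' (this.trans hZ) hc |>.2

/-- A weighted average is attained or beaten at a point of positive weight. -/
lemma exists_weight_le {Ω : Type} [Fintype Ω] {μ Z : Ω → ℝ} (hμ : ∀ o, 0 ≤ μ o)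
    (h1 : ∑ o, μ o = 1) {c : ℝ} (hZ : ∑ o, μ o * Z o ≤ c) : ∃ o, μ o ≠ 0 ∧ Z o ≤ c := by
  by_contra! hcon
  have hlt : ∑ o, μ o * c < ∑ o, μ o * Z o := by
    apply Finset.sum_lt_sum
    · intro o _
      by_cases ho : μ o = 0
      · simp [ho]
      · exact mul_le_mul_of_nonneg_left (hcon o ho).le (hμ o)
    · obtain ⟨o, _, ho⟩ := Finset.exists_ne_zero_of_sum_ne_zero (by rw [h1]; norm_num :
        ∑ o, μ o ≠ 0)
      exact ⟨o, Finset.mem_univ _, mul_lt_mul_of_pos_left (hcon o ho)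
        (lt_of_le_of_ne (hμ o) (Ne.symm ho))⟩
  rw [← Finset.sum_mul, h1] at hlt
  linarith

end RandomFunctions

section RandomBinning

variable {A A₁ U Uh : Type} [Fintype A] [Fintype A₁] [Fintype U] [Fintype Uh]

/-- The weight of a random pair of binning functions. -/
def binWeight (PU : U → ℝ) (K : U → Uh → ℝ) (o : (A₁ → U) × (A × U → Uh)) : ℝ :=
  funWeight (fun _ => PU) o.1 * funWeight (fun au : A × U => K au.2) o.2

/-- The indicator that `a` is sent to `(u, uh)` by a pair of binning functions. -/
def binInd (pr : A → A₁) (u : U) (uh : Uh) (a : A) (o : (A₁ → U) × (A × U → Uh)) : ℝ :=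
  ind (o.1 (pr a)) u * ind (o.2 (a, u)) uh

variable {PU : U → ℝ} {K : U → Uh → ℝ}

omit [Fintype Uh] in
lemma binWeight_nonneg (hPU : ∀ u, 0 ≤ PU u) (hK : ∀ u uh, 0 ≤ K u uh)
    (o : (A₁ → U) × (A × U → Uh)) : 0 ≤ binWeight PU K o :=
  mul_nonneg (funWeight_nonneg (fun _ => hPU) _) (funWeight_nonneg (fun au : A × U => hK au.2) _)

lemma sum_binWeight_mul (φ : (A₁ → U) → ℝ) (ψ : (A × U → Uh) → ℝ) :
    ∑ o : (A₁ → U) × (A × U → Uh), binWeight PU K o * (φ o.1 * ψ o.2) =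
      (∑ f, funWeight (fun _ => PU) f * φ f) *
        ∑ g, funWeight (fun au : A × U => K au.2) g * ψ g := by
  rw [Finset.sum_mul_sum, Fintype.sum_prod_type]
  refine Finset.sum_congr rfl fun f _ => Finset.sum_congr rfl fun g _ => ?_
  simp only [binWeight]; ring

variable (hPU : ∑ u, PU u = 1) (hK : ∀ u, ∑ uh, K u uh = 1)

include hPU hK

lemma sum_binWeight : ∑ o : (A₁ → U) × (A × U → Uh), binWeight PU K o = 1 := by
  have := sum_binWeight_mul (A₁ := A₁) (A := A) (PU := PU) (K := K) (fun _ => 1) (fun _ => 1)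
  simpa [sum_funWeight (w := fun _ : A₁ => PU) (fun _ => hPU),
    sum_funWeight (w := fun au : A × U => K au.2) (fun au : A × U => hK au.2)] using this

lemma sum_binWeight_binInd (pr : A → A₁) (u : U) (uh : Uh) (a : A) :
    ∑ o, binWeight PU K o * binInd pr u uh a o = PU u * K u uh := by
  have := sum_binWeight_mul (A₁ := A₁) (A := A) (PU := PU) (K := K)
    (fun f => ind (f (pr a)) u) (fun g => ind (g (a, u)) uh)
  rw [sum_funWeight_ind (w := fun _ : A₁ => PU) (fun _ => hPU),
    sum_funWeight_ind (w := fun au : A × U => K au.2) (fun au : A × U => hK au.2)] at this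
  exact this

lemma sum_binWeight_binInd_binInd_le (hPU0 : ∀ u, 0 ≤ PU u) (hK0 : ∀ u uh, 0 ≤ K u uh)
    (pr : A → A₁) (u : U) (uh : Uh) (a a' : A) :
    ∑ o, binWeight PU K o * (binInd pr u uh a o * binInd pr u uh a' o) ≤
      (PU u * K u uh) ^ 2 + ind (pr a') (pr a) * (PU u * K u uh ^ 2) +
        ind a' a * (PU u * K u uh) := by
  have hp := mul_nonneg (hPU0 u) (hK0 u uh)
  have hp2 := mul_nonneg (hPU0 u) (sq_nonneg (K u uh))
  by_cases haa : a' = a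
  · subst haa
    have h1 : ∀ o, binInd pr u uh a' o * binInd pr u uh a' o = binInd pr u uh a' o := by
      intro o
      calc _ = (ind (o.1 (pr a')) u * ind (o.1 (pr a')) u) *
            (ind (o.2 (a', u)) uh * ind (o.2 (a', u)) uh) := by simp only [binInd]; ring
        _ = _ := by rw [ind_mul_self, ind_mul_self]; rfl
    simp only [h1]
    rw [sum_binWeight_binInd hPU hK]
    have : ind a' a' = 1 := by simp [ind]
    have h3 : ind (pr a') (pr a') = 1 := by simp [ind]
    rw [this, h3]; nlinarith [sq_nonneg (PU u * K u uh)]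
  · have h0 : ∀ o, binInd pr u uh a o * binInd pr u uh a' o =
        (ind (o.1 (pr a)) u * ind (o.1 (pr a')) u) *
          (ind (o.2 (a, u)) uh * ind (o.2 (a', u)) uh) := by
      intro o; simp only [binInd]; ring
    simp only [h0]
    rw [sum_binWeight_mul (A₁ := A₁) (A := A) (PU := PU) (K := K)
      (fun f => ind (f (pr a)) u * ind (f (pr a')) u)
      (fun g => ind (g (a, u)) uh * ind (g (a', u)) uh),
      sum_funWeight_ind_ind (w := fun au : A × U => K au.2) (fun au : A × U => hK au.2)
        (i := (a, u)) (i' := (a', u)) (by simpa using fun h => haa h.symm)]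
    have h4 : ind a' a = 0 := by simp [ind, haa]
    by_cases hpr : pr a' = pr a
    · rw [hpr]
      simp only [ind_mul_self]
      rw [sum_funWeight_ind (w := fun _ : A₁ => PU) (fun _ => hPU)]
      have : ind (pr a) (pr a) = 1 := by simp [ind]
      rw [this, h4]; nlinarith [sq_nonneg (PU u * K u uh)]
    · rw [sum_funWeight_ind_ind (w := fun _ : A₁ => PU) (fun _ => hPU)
        (fun h => hpr h.symm)]
      have : ind (pr a') (pr a) = 0 := by simp [ind, hpr]
      rw [this, h4]; apply le_of_eq; ring

/-- Second-moment bound for the random mass `∑ a, q a * binInd a`. -/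
lemma sum_binWeight_sq_le (hPU0 : ∀ u, 0 ≤ PU u) (hK0 : ∀ u uh, 0 ≤ K u uh)
    (pr : A → A₁) (u : U) (uh : Uh) {q : A → ℝ} (hq : ∀ a, 0 ≤ q a) {x : ℝ}
    (hqx : ∑ a, q a ≤ x) {τ : ℝ} (hτ : 0 ≤ τ)
    (h1 : ∀ a, q a ≠ 0 → ∑ a', q a' * ind (pr a') (pr a) ≤ τ * x * PU u)
    (h2 : ∀ a, q a ≠ 0 → q a ≤ τ * x * (PU u * K u uh)) :
    ∑ o, binWeight PU K o * (∑ a, q a * binInd pr u uh a o - (∑ a, q a) * (PU u * K u uh)) ^ 2 ≤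
      2 * τ * (x * (PU u * K u uh)) ^ 2 := by
  set P := PU u * K u uh with hP
  have hP0 : 0 ≤ P := mul_nonneg (hPU0 u) (hK0 u uh)
  have hx : 0 ≤ x := (Finset.sum_nonneg fun a _ => hq a).trans hqx
  have hexp : ∀ o : (A₁ → U) × (A × U → Uh),
      (∑ a, q a * binInd pr u uh a o - (∑ a, q a) * P) ^ 2 =
      ∑ a, ∑ a', q a * q a' * (binInd pr u uh a o * binInd pr u uh a' o
        - P * binInd pr u uh a o - P * binInd pr u uh a' o + P ^ 2) := by
    intro o
    rw [Finset.sum_mul, ← Finset.sum_sub_distrib, sq, Finset.sum_mul_sum]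
    refine Finset.sum_congr rfl fun a _ => Finset.sum_congr rfl fun a' _ => ?_
    ring
  have hlin : ∀ a a', ∑ o, binWeight PU K o * (binInd pr u uh a o * binInd pr u uh a' o
        - P * binInd pr u uh a o - P * binInd pr u uh a' o + P ^ 2) ≤
      ind (pr a') (pr a) * (PU u * K u uh ^ 2) + ind a' a * P := by
    intro a a'
    have e1 : ∑ o, binWeight PU K o * (binInd pr u uh a o * binInd pr u uh a' o
        - P * binInd pr u uh a o - P * binInd pr u uh a' o + P ^ 2) =
        ∑ o, binWeight PU K o * (binInd pr u uh a o * binInd pr u uh a' o)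
        - P * ∑ o, binWeight PU K o * binInd pr u uh a o
        - P * ∑ o, binWeight PU K o * binInd pr u uh a' o
        + P ^ 2 * ∑ o : (A₁ → U) × (A × U → Uh), binWeight PU K o := by
      simp only [Finset.mul_sum, ← Finset.sum_sub_distrib, ← Finset.sum_add_distrib]
      exact Finset.sum_congr rfl fun o _ => by ring
    rw [e1, sum_binWeight_binInd hPU hK, sum_binWeight_binInd hPU hK, sum_binWeight hPU hK, ← hP]
    have := sum_binWeight_binInd_binInd_le hPU hK hPU0 hK0 pr u uh a a'
    rw [← hP] at this
    nlinarith
  have hswap : ∑ o, binWeight PU K o *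
        (∑ a, q a * binInd pr u uh a o - (∑ a, q a) * P) ^ 2 =
      ∑ a, ∑ a', q a * q a' * ∑ o, binWeight PU K o *
        (binInd pr u uh a o * binInd pr u uh a' o
        - P * binInd pr u uh a o - P * binInd pr u uh a' o + P ^ 2) := by
    simp only [hexp, Finset.mul_sum]
    rw [Finset.sum_comm]
    refine Finset.sum_congr rfl fun a _ => ?_
    rw [Finset.sum_comm]
    refine Finset.sum_congr rfl fun a' _ => Finset.sum_congr rfl fun o _ => ?_
    ring
  rw [hswap]
  have hterm : ∀ a, ∑ a', q a * q a' * ∑ o, binWeight PU K o *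
        (binInd pr u uh a o * binInd pr u uh a' o
        - P * binInd pr u uh a o - P * binInd pr u uh a' o + P ^ 2) ≤
      q a * (2 * τ * x * P ^ 2) := by
    intro a
    by_cases ha : q a = 0
    · simp [ha]
    calc _ ≤ ∑ a', q a * q a' * (ind (pr a') (pr a) * (PU u * K u uh ^ 2) + ind a' a * P) :=
          Finset.sum_le_sum fun a' _ =>
            mul_le_mul_of_nonneg_left (hlin a a') (mul_nonneg (hq a) (hq a'))
      _ = q a * ((PU u * K u uh ^ 2) * ∑ a', q a' * ind (pr a') (pr a) +
            P * ∑ a', q a' * ind a' a) := by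
          simp only [Finset.mul_sum, ← Finset.sum_add_distrib]
          exact Finset.sum_congr rfl fun a' _ => by ring
      _ ≤ q a * ((PU u * K u uh ^ 2) * (τ * x * PU u) + P * (τ * x * P)) := by
          rw [sum_mul_ind]
          refine mul_le_mul_of_nonneg_left (add_le_add ?_ ?_) (hq a)
          · exact mul_le_mul_of_nonneg_left (h1 a ha) (mul_nonneg (hPU0 u) (sq_nonneg _))
          · exact mul_le_mul_of_nonneg_left (h2 a ha) hP0
      _ = q a * (2 * τ * x * P ^ 2) := by rw [hP]; ring
  calc _ ≤ ∑ a, q a * (2 * τ * x * P ^ 2) := Finset.sum_le_sum fun a _ => hterm a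
    _ = (∑ a, q a) * (2 * τ * x * P ^ 2) := by rw [Finset.sum_mul]
    _ ≤ x * (2 * τ * x * P ^ 2) := mul_le_mul_of_nonneg_right hqx (by positivity)
    _ = _ := by ring

end RandomBinning

section OneShot

variable {A A₁ E U Uh : Type} [Fintype A] [Fintype A₁] [Fintype E] [Fintype U] [Fintype Uh]

lemma marg_nonneg {α β : Type} [Fintype α] (f : α → β) {p : α → ℝ} (hp : ∀ a, 0 ≤ p a) (b : β) :
    0 ≤ marg f p b := by
  unfold marg
  exact Finset.sum_nonneg fun a _ => by split_ifs <;> simp [hp]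

lemma sum_marg {α β : Type} [Fintype α] [Fintype β] (f : α → β) (p : α → ℝ) :
    ∑ b, marg f p b = ∑ a, p a := by
  unfold marg
  rw [Finset.sum_comm]
  simp

lemma marg_eq_sum_mul_ind {α β : Type} [Fintype α] (f : α → β) (p : α → ℝ) (b : β) :
    marg f p b = ∑ a, p a * ind (f a) b := by
  simp [marg, ind]

/-- A joint mass function on a product factors through its first marginal. -/
lemma exists_condKernel {P : U × Uh → ℝ} (hP : IsDist P) :
    ∃ K : U → Uh → ℝ, (∀ u uh, 0 ≤ K u uh) ∧ (∀ u, ∑ uh, K u uh = 1) ∧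
      ∀ u uh, marg Prod.fst P u * K u uh = P (u, uh) := by
  obtain ⟨s, -, -⟩ := Finset.exists_ne_zero_of_sum_ne_zero
    (by rw [hP.2]; norm_num : ∑ s, P s ≠ 0)
  have hm : ∀ u, marg Prod.fst P u = ∑ uh, P (u, uh) := by
    intro u
    simp only [marg, Fintype.sum_prod_type]
    rw [Finset.sum_comm]
    simp
  refine ⟨fun u uh => if marg Prod.fst P u = 0 then ind uh s.2 else P (u, uh) / marg Prod.fst P u,
    ?_, ?_, ?_⟩
  · intro u uh
    dsimp only
    split_ifs
    · exact ind_nonneg _ _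
    · exact div_nonneg (hP.1 _) (marg_nonneg _ hP.1 _)
  · intro u
    dsimp only
    split_ifs with h
    · simp [ind]
    · rw [← Finset.sum_div, ← hm, div_self h]
  · intro u uh
    dsimp only
    split_ifs with h
    · rw [h, zero_mul]
      rw [hm] at h
      exact ((Finset.sum_eq_zero_iff_of_nonneg fun _ _ => hP.1 _).1 h uh (Finset.mem_univ _)).symm
    · field_simp

/-- The pairs of source symbol and target for which the source carries enough randomness. -/
def BinGood (p : A → E → ℝ) (pr : A → A₁) (P : U × Uh → ℝ) (τ : ℝ) (a : A) (e : E) (s : U × Uh) :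
    Prop :=
  marg pr (fun a => p a e) (pr a) ≤ τ * (∑ a, p a e) * marg Prod.fst P s.1 ∧
    p a e ≤ τ * (∑ a, p a e) * P s

/-- One-shot nested random binning: a pair of functions, one of `pr a` only and one of `a`,
whose output is close to `P` and nearly independent of the side observation `e`. -/
lemma exists_binning {p : A → E → ℝ} (hp : ∀ a e, 0 ≤ p a e) (hp1 : ∑ a, ∑ e, p a e = 1)
    (pr : A → A₁) {P : U × Uh → ℝ} (hP : IsDist P) {τ : ℝ} (hτ : 0 ≤ τ) :
    ∃ (f : A₁ → U) (g : A → Uh), (∀ a, P (f (pr a), g a) ≠ 0) ∧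
      ∑ e, ∑ s, |marg (fun a => (f (pr a), g a)) (fun a => p a e) s - (∑ a, p a e) * P s| ≤
        2 * (∑ a, ∑ e, ∑ s, if BinGood p pr P τ a e s then 0 else p a e * P s) +
          √(2 * τ) := by
  obtain ⟨K, hK0, hK1, hKP⟩ := exists_condKernel hP
  set PU := marg Prod.fst P with hPU
  have hPU0 : ∀ u, 0 ≤ PU u := fun u => marg_nonneg _ hP.1 u
  have hPU1 : ∑ u, PU u = 1 := by rw [hPU, sum_marg, hP.2]
  let μ : (A₁ → U) × (A × U → Uh) → ℝ := binWeight PU K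
  have hμ0 : ∀ o, 0 ≤ μ o := fun o => binWeight_nonneg hPU0 hK0 o
  have hμ1 : ∑ o, μ o = 1 := sum_binWeight hPU1 hK1
  let q : E → U × Uh → A → ℝ := fun e s a => if BinGood p pr P τ a e s then p a e else 0
  have hq0 : ∀ e s a, 0 ≤ q e s a := fun e s a => by
    simp only [q]; split_ifs <;> simp [hp]
  have hqp : ∀ e s a, q e s a ≤ p a e := fun e s a => by
    simp only [q]; split_ifs <;> simp [hp]
  have hmain : ∀ e s, ∑ o, μ o *
      |∑ a, p a e * binInd pr s.1 s.2 a o - (∑ a, p a e) * P s| ≤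
      2 * (∑ a, (p a e - q e s a)) * P s + √(2 * τ) * ((∑ a, p a e) * P s) := by
    intro e s
    have hx : 0 ≤ ∑ a, p a e := Finset.sum_nonneg fun a _ => hp a e
    have hs : P s = PU s.1 * K s.1 s.2 := (hKP _ _).symm
    have hvar := sum_binWeight_sq_le hPU1 hK1 hPU0 hK0 pr s.1 s.2 (hq0 e s)
      (Finset.sum_le_sum fun a _ => hqp e s a) hτ
      (by
        intro a ha
        have hg : BinGood p pr P τ a e s := by
          by_contra hg; exact ha (by simp [q, hg])
        refine le_trans ?_ hg.1
        rw [marg_eq_sum_mul_ind]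
        exact Finset.sum_le_sum fun a' _ =>
          mul_le_mul_of_nonneg_right (hqp e s a') (ind_nonneg _ _))
      (by
        intro a ha
        have hg : BinGood p pr P τ a e s := by
          by_contra hg; exact ha (by simp [q, hg])
        rw [← hs]
        exact (hqp e s a).trans hg.2)
    rw [← hs] at hvar
    have hdev : ∑ o, μ o * |∑ a, q e s a * binInd pr s.1 s.2 a o - (∑ a, q e s a) * P s| ≤
        √(2 * τ) * ((∑ a, p a e) * P s) := by
      refine sum_weight_abs_le hμ0 hμ1
        (mul_nonneg (Real.sqrt_nonneg _) (mul_nonneg hx (hP.1 s))) (hvar.trans (le_of_eq ?_))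
      rw [mul_pow (√(2 * τ)), Real.sq_sqrt (by positivity : 0 ≤ 2 * τ)]
    have hpt : ∀ o, μ o * |∑ a, p a e * binInd pr s.1 s.2 a o - (∑ a, p a e) * P s| ≤
        μ o * |∑ a, q e s a * binInd pr s.1 s.2 a o - (∑ a, q e s a) * P s| +
        (μ o * ∑ a, (p a e - q e s a) * binInd pr s.1 s.2 a o) +
        μ o * ((∑ a, (p a e - q e s a)) * P s) := by
      intro o
      rw [← mul_add, ← mul_add]
      refine mul_le_mul_of_nonneg_left ?_ (hμ0 o)
      have e1 : ∑ a, p a e * binInd pr s.1 s.2 a o - (∑ a, p a e) * P s =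
          (∑ a, q e s a * binInd pr s.1 s.2 a o - (∑ a, q e s a) * P s) +
          (∑ a, (p a e - q e s a) * binInd pr s.1 s.2 a o) -
          (∑ a, (p a e - q e s a)) * P s := by
        simp only [sub_mul, Finset.sum_sub_distrib]; ring
      have n1 : 0 ≤ ∑ a, (p a e - q e s a) * binInd pr s.1 s.2 a o :=
        Finset.sum_nonneg fun a _ => mul_nonneg (sub_nonneg.2 (hqp e s a))
          (mul_nonneg (ind_nonneg _ _) (ind_nonneg _ _))
      have n2 : 0 ≤ (∑ a, (p a e - q e s a)) * P s :=
        mul_nonneg (Finset.sum_nonneg fun a _ => sub_nonneg.2 (hqp e s a)) (hP.1 s)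
      rw [e1]
      refine (abs_sub _ _).trans (add_le_add ((abs_add_le _ _).trans ?_) ?_)
      · rw [abs_of_nonneg n1]
      · rw [abs_of_nonneg n2]
    have hmid : ∑ o, μ o * ∑ a, (p a e - q e s a) * binInd pr s.1 s.2 a o =
        (∑ a, (p a e - q e s a)) * P s := by
      simp only [Finset.mul_sum]
      rw [Finset.sum_comm, Finset.sum_mul]
      refine Finset.sum_congr rfl fun a _ => ?_
      rw [hs, ← sum_binWeight_binInd hPU1 hK1 pr s.1 s.2 a, Finset.mul_sum]
      exact Finset.sum_congr rfl fun o _ => by simp only [μ]; ring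
    refine (Finset.sum_le_sum fun o _ => hpt o).trans ?_
    rw [Finset.sum_add_distrib, Finset.sum_add_distrib, hmid, ← Finset.sum_mul, hμ1]
    linarith
  have havg : ∑ o, μ o * ∑ e, ∑ s,
      |∑ a, p a e * binInd pr s.1 s.2 a o - (∑ a, p a e) * P s| ≤
      2 * (∑ a, ∑ e, ∑ s, if BinGood p pr P τ a e s then 0 else p a e * P s) + √(2 * τ) := by
    have e1 : ∑ o, μ o * ∑ e, ∑ s,
        |∑ a, p a e * binInd pr s.1 s.2 a o - (∑ a, p a e) * P s| =
        ∑ e, ∑ s, ∑ o, μ o *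
          |∑ a, p a e * binInd pr s.1 s.2 a o - (∑ a, p a e) * P s| := by
      simp only [Finset.mul_sum]
      rw [Finset.sum_comm]
      exact Finset.sum_congr rfl fun e _ => Finset.sum_comm
    rw [e1]
    refine (Finset.sum_le_sum fun e _ => Finset.sum_le_sum fun s _ => hmain e s).trans ?_
    have e2 : ∑ e, ∑ s, √(2 * τ) * ((∑ a, p a e) * P s) = √(2 * τ) := by
      simp only [← Finset.mul_sum, hP.2, mul_one]
      rw [Finset.sum_comm, hp1, mul_one]
    have e3 : ∑ e, ∑ s, 2 * (∑ a, (p a e - q e s a)) * P s =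
        2 * (∑ a, ∑ e, ∑ s, if BinGood p pr P τ a e s then 0 else p a e * P s) := by
      have : ∀ e s, 2 * (∑ a, (p a e - q e s a)) * P s =
          ∑ a, 2 * (if BinGood p pr P τ a e s then 0 else p a e * P s) := by
        intro e s
        rw [Finset.mul_sum, Finset.sum_mul]
        refine Finset.sum_congr rfl fun a _ => ?_
        simp only [q]
        split_ifs
        · simp
        · ring
      simp only [this, ← Finset.mul_sum]
      congr 1
      rw [Finset.sum_comm' (t' := Finset.univ) (s' := fun _ => Finset.univ) (by simp)]
      rw [Finset.sum_congr rfl fun s _ => Finset.sum_comm]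
      rw [Finset.sum_comm]
      refine Finset.sum_congr rfl fun a _ => ?_
      rw [Finset.sum_comm]
    simp only [Finset.sum_add_distrib]
    rw [e2, e3]
  obtain ⟨o, ho, hle⟩ := exists_weight_le hμ0 hμ1 havg
  refine ⟨o.1, fun a => o.2 (a, o.1 (pr a)), ?_, ?_⟩
  · intro a
    rw [← hKP]
    have h1 : funWeight (fun _ : A₁ => PU) o.1 ≠ 0 := left_ne_zero_of_mul ho
    have h2 : funWeight (fun au : A × U => K au.2) o.2 ≠ 0 := right_ne_zero_of_mul ho
    exact mul_ne_zero (Finset.prod_ne_zero_iff.1 h1 _ (Finset.mem_univ _))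
      (Finset.prod_ne_zero_iff.1 h2 (a, o.1 (pr a)) (Finset.mem_univ _))
  · refine le_trans (le_of_eq ?_) hle
    refine Finset.sum_congr rfl fun e _ => Finset.sum_congr rfl fun s _ => ?_
    congr 2
    rw [marg_eq_sum_mul_ind]
    refine Finset.sum_congr rfl fun a _ => ?_
    congr 1
    obtain ⟨u, uh⟩ := s
    simp only [binInd, ind, Prod.mk.injEq]
    by_cases h1 : o.1 (pr a) = u
    · subst h1; simp
    · simp [h1]

end OneShot

section Blocks

variable {ι Ω S : Type} [Fintype Ω]

/-- The product weight along a sequence `v` of letter types. -/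
def blockProd {ι Ω : Type} (p : ι → Ω → ℝ) {m : ℕ} (v : Fin m → ι) (ω : Fin m → Ω) : ℝ :=
  ∏ t, p (v t) (ω t)

/-- Each letter type `i` occurs `N * c i` times in the sequence `v`. -/
def HasCounts {ι : Type} [Fintype ι] {m : ℕ} (v : Fin m → ι) (N : ℕ) (c : ι → ℕ) : Prop :=
  ∀ F : ι → ℝ, ∑ t, F (v t) = N * ∑ i, c i * F i

lemma exists_hasCounts {ι : Type} [Fintype ι] (N : ℕ) (c : ι → ℕ) :
    ∃ (m : ℕ) (v : Fin m → ι), HasCounts v N c := by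
  let T := Fin N × (Σ i : ι, Fin (c i))
  refine ⟨Fintype.card T, fun t => ((Fintype.equivFin T).symm t).2.1, fun F => ?_⟩
  rw [Equiv.sum_comp (Fintype.equivFin T).symm (fun x : T => F x.2.1), Fintype.sum_prod_type]
  simp [Fintype.sum_sigma]

lemma blockProd_nonneg {ι Ω : Type} {p : ι → Ω → ℝ} (hp : ∀ i ω, 0 ≤ p i ω) {m : ℕ}
    (v : Fin m → ι) (ω : Fin m → Ω) : 0 ≤ blockProd p v ω :=
  Finset.prod_nonneg fun _ _ => hp _ _

lemma sum_blockProd (p : ι → Ω → ℝ) {m : ℕ} (v : Fin m → ι) :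
    ∑ ω, blockProd p v ω = ∏ t, ∑ ω, p (v t) ω := by
  simp only [blockProd]
  rw [Fintype.prod_sum]

lemma sum_blockProd_eq_one {p : ι → Ω → ℝ} (hp : ∀ i, ∑ ω, p i ω = 1) {m : ℕ}
    (v : Fin m → ι) : ∑ ω, blockProd p v ω = 1 := by
  rw [sum_blockProd]; simp [hp]

lemma isDist_blockProd {p : ι → Ω → ℝ} (hp : ∀ i, IsDist (p i)) {m : ℕ}
    (v : Fin m → ι) : IsDist (blockProd p v) :=
  ⟨blockProd_nonneg (fun i => (hp i).1) v, sum_blockProd_eq_one (fun i => (hp i).2) v⟩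

lemma marg_prod {Γ : Type} (k : Ω → Γ) {m : ℕ} (w : Fin m → Ω → ℝ) (b : Fin m → Γ) :
    marg (fun (ω : Fin m → Ω) t => k (ω t)) (fun ω => ∏ t, w t (ω t)) b =
      ∏ t, marg k (w t) (b t) := by
  simp only [marg]
  rw [Fintype.prod_sum]
  refine Finset.sum_congr rfl fun ω _ => ?_
  by_cases h : (fun t => k (ω t)) = b
  · subst h; simp
  · rw [if_neg h]
    obtain ⟨t, ht⟩ := Function.ne_iff.1 h
    exact (Finset.prod_eq_zero (Finset.mem_univ t) (by simp [ht])).symm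

lemma le_marg {α β : Type} [Fintype α] (f : α → β) {p : α → ℝ} (hp : ∀ a, 0 ≤ p a) (a : α) :
    p a ≤ marg f p (f a) := by
  unfold marg
  refine le_trans (by simp) (Finset.single_le_sum (f := fun a' => if f a' = f a then p a' else 0)
    (fun a' _ => by split_ifs <;> simp [hp]) (Finset.mem_univ a))

lemma sum_marg_mul {α β : Type} [Fintype α] [Fintype β] (f : α → β) (p : α → ℝ) (φ : β → ℝ) :
    ∑ b, marg f p b * φ b = ∑ a, p a * φ (f a) := by
  simp only [marg, Finset.sum_mul]
  rw [Finset.sum_comm]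
  simp [ite_mul]

lemma ent_marg_eq {α β : Type} [Fintype α] [Fintype β] (f : α → β) (p : α → ℝ) :
    ent (marg f p) = -∑ a, p a * Real.log (marg f p (f a)) := by
  rw [← sum_marg_mul f p fun b => Real.log (marg f p b), ent, ← Finset.sum_neg_distrib]
  exact Finset.sum_congr rfl fun b _ => by rw [Real.negMulLog]; ring

variable [Fintype ι] [Fintype S]

lemma mgf_le {p : ι → Ω → ℝ} (hp : ∀ i, IsDist (p i)) (h : ι → Ω → ℝ) :
    ∃ C : ℝ, 0 ≤ C ∧ ∃ s₀ : ℝ, 0 < s₀ ∧ ∀ s, 0 ≤ s → s ≤ s₀ → ∀ i,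
      ∑ ω, p i ω * Real.exp (s * h i ω) ≤
        Real.exp (s * (∑ ω, p i ω * h i ω) + C * s ^ 2) := by
  set H : ℝ := 1 + ∑ i, ∑ ω, |h i ω| with hH
  have hsum0 : 0 ≤ ∑ i, ∑ ω, |h i ω| :=
    Finset.sum_nonneg fun _ _ => Finset.sum_nonneg fun _ _ => abs_nonneg _
  have hH0 : 0 < H := by linarith
  have hle : ∀ i ω, |h i ω| ≤ H := by
    intro i ω
    have h1 := Finset.single_le_sum (f := fun ω => |h i ω|) (fun _ _ => abs_nonneg _)
      (Finset.mem_univ ω)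
    have h2 := Finset.single_le_sum (f := fun i => ∑ ω, |h i ω|)
      (fun _ _ => Finset.sum_nonneg fun _ _ => abs_nonneg _) (Finset.mem_univ i)
    linarith
  refine ⟨H ^ 2, sq_nonneg _, 1 / H, by positivity, fun s hs hs1 i => ?_⟩
  have hsH : s * H ≤ 1 := by rwa [le_div_iff₀ hH0] at hs1
  have hpt : ∀ ω, Real.exp (s * h i ω) ≤ 1 + s * h i ω + H ^ 2 * s ^ 2 := by
    intro ω
    have habs : |s * h i ω| ≤ s * H := by
      rw [abs_mul, abs_of_nonneg hs]; exact mul_le_mul_of_nonneg_left (hle i ω) hs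
    have h1 := abs_le.1 (Real.abs_exp_sub_one_sub_id_le (habs.trans hsH))
    have h2 : (s * h i ω) ^ 2 ≤ (s * H) ^ 2 := sq_le_sq' (by linarith [(abs_le.1 habs).1])
      (abs_le.1 habs).2
    nlinarith [h1.2]
  calc ∑ ω, p i ω * Real.exp (s * h i ω)
      ≤ ∑ ω, p i ω * (1 + s * h i ω + H ^ 2 * s ^ 2) :=
        Finset.sum_le_sum fun ω _ => mul_le_mul_of_nonneg_left (hpt ω) ((hp i).1 ω)
    _ = (s * (∑ ω, p i ω * h i ω) + H ^ 2 * s ^ 2) + 1 := by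
        have : ∀ ω, p i ω * (1 + s * h i ω + H ^ 2 * s ^ 2) =
            p i ω + s * (p i ω * h i ω) + H ^ 2 * s ^ 2 * p i ω := fun ω => by ring
        simp only [this, Finset.sum_add_distrib, ← Finset.mul_sum, (hp i).2]
        ring
    _ ≤ _ := Real.add_one_le_exp _

lemma sum_blockProd_mul_exp {ι : Type} (p h : ι → Ω → ℝ) (s : ℝ) {m : ℕ} (v : Fin m → ι) :
    ∑ ω, blockProd p v ω * Real.exp (s * ∑ t, h (v t) (ω t)) =
      ∏ t, ∑ ω, p (v t) ω * Real.exp (s * h (v t) ω) := by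
  rw [Fintype.prod_sum]
  refine Finset.sum_congr rfl fun ω _ => ?_
  rw [Finset.mul_sum, Real.exp_sum, blockProd, Finset.prod_mul_distrib]

lemma sum_blockProd_mul_exp_le {p h : ι → Ω → ℝ} (hp : ∀ i, IsDist (p i)) {s C : ℝ}
    (hC : ∀ i, ∑ ω, p i ω * Real.exp (s * h i ω) ≤
        Real.exp (s * (∑ ω, p i ω * h i ω) + C * s ^ 2)) {m N : ℕ} {v : Fin m → ι} {c : ι → ℕ}
    (hv : HasCounts v N c) :
    ∑ ω, blockProd p v ω * Real.exp (s * ∑ t, h (v t) (ω t)) ≤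
      Real.exp (N * (s * (∑ i, c i * ∑ ω, p i ω * h i ω) + C * s ^ 2 * ∑ i, (c i : ℝ))) := by
  rw [sum_blockProd_mul_exp]
  refine (Finset.prod_le_prod (fun t _ => Finset.sum_nonneg fun ω _ =>
    mul_nonneg ((hp _).1 _) (Real.exp_nonneg _)) fun t _ => hC (v t)).trans (le_of_eq ?_)
  rw [← Real.exp_sum, hv fun i => s * (∑ ω, p i ω * h i ω) + C * s ^ 2]
  congr 2
  rw [Finset.mul_sum, Finset.mul_sum, ← Finset.sum_add_distrib]
  exact Finset.sum_congr rfl fun i _ => by ring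

/-- Chernoff bound for a sum of independent terms over a pair of blocks. -/
lemma chernoff_pair {p h : ι → Ω → ℝ} (hp : ∀ i, IsDist (p i)) {q k : ι → S → ℝ}
    (hq : ∀ i, IsDist (q i)) {c' c : ι → ℕ}
    (hneg : ∑ i, c' i * ∑ ω, p i ω * h i ω + ∑ i, c i * ∑ s, q i s * k i s < 0) :
    ∃ r : ℝ, 0 < r ∧ ∃ η : ℝ, 0 < η ∧ ∀ (N m m' : ℕ) (v : Fin m → ι) (v' : Fin m' → ι),
      HasCounts v N c' → HasCounts v' N c →
      ∑ ω, ∑ s, (if -(r * N) < ∑ t, h (v t) (ω t) + ∑ j, k (v' j) (s j)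
        then blockProd p v ω * blockProd q v' s else 0) ≤ Real.exp (-(η * N)) := by
  obtain ⟨C₁, hC₁, s₁, hs₁, h₁⟩ := mgf_le hp h
  obtain ⟨C₂, hC₂, s₂, hs₂, h₂⟩ := mgf_le hq k
  set γ : ℝ := -(∑ i, c' i * ∑ ω, p i ω * h i ω + ∑ i, c i * ∑ s, q i s * k i s) with hγ
  have hγ0 : 0 < γ := by rw [hγ]; linarith
  set D : ℝ := C₁ * ∑ i, (c' i : ℝ) + C₂ * ∑ i, (c i : ℝ) with hD
  have hD0 : 0 ≤ D := by positivity
  set s : ℝ := min (min s₁ s₂) (γ / (4 * (D + 1))) with hs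
  have hs0 : 0 < s := lt_min (lt_min hs₁ hs₂) (by positivity)
  have hsD : D * s ≤ γ / 4 := by
    have h1 : s ≤ γ / (4 * (D + 1)) := min_le_right _ _
    rw [le_div_iff₀ (by positivity)] at h1
    nlinarith
  refine ⟨γ / 4, by positivity, s * γ / 2, by positivity, fun N m m' v v' hv hv' => ?_⟩
  have e1 := sum_blockProd_mul_exp_le hp
    (h₁ s hs0.le ((min_le_left _ _).trans (min_le_left _ _))) hv
  have e2 := sum_blockProd_mul_exp_le hq
    (h₂ s hs0.le ((min_le_left _ _).trans (min_le_right _ _))) hv'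
  calc _ ≤ ∑ ω, ∑ x, Real.exp (s * (γ / 4 * N)) *
        ((blockProd p v ω * Real.exp (s * ∑ t, h (v t) (ω t))) *
          (blockProd q v' x * Real.exp (s * ∑ j, k (v' j) (x j)))) := by
        refine Finset.sum_le_sum fun ω _ => Finset.sum_le_sum fun x _ => ?_
        have hp0 := blockProd_nonneg (fun i => (hp i).1) v ω
        have hq0 := blockProd_nonneg (fun i => (hq i).1) v' x
        split_ifs with hc
        · have : 1 ≤ Real.exp (s * (γ / 4 * N)) * Real.exp (s * ∑ t, h (v t) (ω t)) *
              Real.exp (s * ∑ j, k (v' j) (x j)) := by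
            rw [← Real.exp_add, ← Real.exp_add]
            apply Real.one_le_exp
            nlinarith
          calc _ ≤ blockProd p v ω * blockProd q v' x *
                (Real.exp (s * (γ / 4 * N)) * Real.exp (s * ∑ t, h (v t) (ω t)) *
                  Real.exp (s * ∑ j, k (v' j) (x j))) :=
                le_mul_of_one_le_right (mul_nonneg hp0 hq0) this
            _ = _ := by ring
        · positivity
    _ = Real.exp (s * (γ / 4 * N)) *
        ((∑ ω, blockProd p v ω * Real.exp (s * ∑ t, h (v t) (ω t))) *
          ∑ x, blockProd q v' x * Real.exp (s * ∑ j, k (v' j) (x j))) := by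
        simp only [← Finset.mul_sum, ← Finset.sum_mul]
    _ ≤ Real.exp (s * (γ / 4 * N)) * (Real.exp _ * Real.exp _) :=
        mul_le_mul_of_nonneg_left (mul_le_mul e1 e2 (Finset.sum_nonneg fun x _ =>
          mul_nonneg (blockProd_nonneg (fun i => (hq i).1) v' x) (Real.exp_nonneg _))
          (Real.exp_nonneg _)) (Real.exp_nonneg _)
    _ ≤ _ := by
        rw [← Real.exp_add, ← Real.exp_add]
        apply Real.exp_le_exp.2
        have e3 : s * (γ / 4 * N) +
          (N * (s * (∑ i, c' i * ∑ ω, p i ω * h i ω) + C₁ * s ^ 2 * ∑ i, (c' i : ℝ)) +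
            N * (s * (∑ i, c i * ∑ s, q i s * k i s) + C₂ * s ^ 2 * ∑ i, (c i : ℝ))) =
          N * s * (γ / 4 - γ + D * s) := by rw [hγ, hD]; ring
        rw [e3]
        have : N * s * (γ / 4 - γ + D * s) ≤ N * s * (-(γ / 2)) :=
          mul_le_mul_of_nonneg_left (by linarith) (by positivity)
        linarith

end Blocks

section BlockMaps

lemma marg_fst {α β : Type} [Fintype α] [Fintype β] (p : α × β → ℝ) (a : α) :
    marg Prod.fst p a = ∑ b, p (a, b) := by
  simp only [marg, Fintype.sum_prod_type]
  rw [Finset.sum_comm]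
  simp

lemma marg_snd {α β : Type} [Fintype α] [Fintype β] (p : α × β → ℝ) (b : β) :
    marg Prod.snd p b = ∑ a, p (a, b) := by
  simp only [marg, Fintype.sum_prod_type]
  simp

lemma marg_map_fst {α β γ : Type} [Fintype α] [Fintype β] (k : α → γ) (p : α × β → ℝ)
    (c : γ) (b : β) :
    marg (fun x : α × β => (k x.1, x.2)) p (c, b) = marg k (fun a => p (a, b)) c := by
  simp only [marg, Fintype.sum_prod_type, Prod.mk.injEq]
  refine Finset.sum_congr rfl fun a _ => ?_
  by_cases h : k a = c <;> simp [h]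

lemma sum_arrow_prod {m : ℕ} {α β : Type} [Fintype α] [Fintype β]
    (F : (Fin m → α × β) → ℝ) :
    ∑ a : Fin m → α, ∑ b : Fin m → β, F (fun t => (a t, b t)) = ∑ x, F x := by
  rw [← Fintype.sum_prod_type' (f := fun (a : Fin m → α) (b : Fin m → β) =>
    F (fun t => (a t, b t)))]
  exact Equiv.sum_comp (Equiv.arrowProdEquivProdArrow (Fin m) (fun _ => α) (fun _ => β)).symm F

variable {ι Ω Ω₁ E U Uh : Type} [Fintype ι] [Fintype Ω] [Fintype Ω₁] [Fintype E] [Fintype U]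
  [Fintype Uh]

lemma prod_le_of_sum_log_le {m m' : ℕ} {a b : Fin m → ℝ} {k : Fin m' → ℝ} (ha : ∀ t, 0 < a t)
    (hb : ∀ t, 0 < b t) (hk : ∀ j, 0 < k j) {x : ℝ}
    (h : ∑ t, (Real.log (a t) - Real.log (b t)) + ∑ j, -Real.log (k j) ≤ x) :
    ∏ t, a t ≤ Real.exp x * (∏ t, b t) * ∏ j, k j := by
  have e : ∀ {n : ℕ} {z : Fin n → ℝ}, (∀ t, 0 < z t) →
      ∏ t, z t = Real.exp (∑ t, Real.log (z t)) := fun hz => by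
    rw [Real.exp_sum]; exact Finset.prod_congr rfl fun t _ => (Real.exp_log (hz t)).symm
  rw [e ha, e hb, e hk, ← Real.exp_add, ← Real.exp_add]
  apply Real.exp_le_exp.2
  simp only [Finset.sum_sub_distrib, Finset.sum_neg_distrib] at h
  linarith

lemma eventually_small {ε r η : ℝ} (hε : 0 < ε) (hr : 0 < r) (hη : 0 < η) :
    ∃ N₀ : ℕ, ∀ N : ℕ, N₀ ≤ N →
      2 * (2 * Real.exp (-(η * N))) + √(2 * Real.exp (-(r * N))) ≤ ε := by
  have hexp : ∀ {z : ℝ}, 0 < z → Filter.Tendsto (fun N : ℕ => Real.exp (-(z * N)))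
      Filter.atTop (nhds 0) := fun hz =>
    Real.tendsto_exp_neg_atTop_nhds_zero.comp
      (Filter.Tendsto.const_mul_atTop hz tendsto_natCast_atTop_atTop)
  have h1 := ((hexp hη).const_mul 2).const_mul 2
  have h2 := (Real.continuous_sqrt.tendsto _).comp ((hexp hr).const_mul 2)
  have h3 := h1.add h2
  simp only [mul_zero, Real.sqrt_zero, add_zero] at h3
  obtain ⟨N₀, hN₀⟩ := Filter.eventually_atTop.1 (h3.eventually (ge_mem_nhds hε))
  exact ⟨N₀, fun N hN => hN₀ N hN⟩

/-- Nested random binning over blocks: a source block with more conditional entropy than the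
target block can be mapped onto the target, nearly independently of the observations. -/
lemma exists_blockMaps {p : ι → Ω × E → ℝ} (hp : ∀ i, IsDist (p i)) (pr : Ω → Ω₁)
    {κ : ι → U × Uh → ℝ} (hκ : ∀ i, IsDist (κ i)) {c' c : ι → ℕ}
    (gap₁ : ∑ i, c i * ent (marg Prod.fst (κ i)) <
      ∑ i, c' i * (ent (marg (fun x : Ω × E => (pr x.1, x.2)) (p i)) -
        ent (marg Prod.snd (p i))))
    (gap₂ : ∑ i, c i * ent (κ i) < ∑ i, c' i * (ent (p i) - ent (marg Prod.snd (p i))))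
    {ε : ℝ} (hε : 0 < ε) :
    ∃ N₀ : ℕ, ∀ N, N₀ ≤ N → ∀ (m m' : ℕ) (v : Fin m → ι) (v' : Fin m' → ι),
      HasCounts v N c' → HasCounts v' N c →
      ∃ (f : (Fin m → Ω₁) → Fin m' → U) (g : (Fin m → Ω) → Fin m' → Uh),
        (∀ ω j, κ (v' j) (f (fun t => pr (ω t)) j, g ω j) ≠ 0) ∧
        ∑ e, ∑ s, |marg (fun ω j => (f (fun t => pr (ω t)) j, g ω j))
            (fun ω => blockProd p v (fun t => (ω t, e t))) s -
          blockProd (fun i => marg Prod.snd (p i)) v e * blockProd κ v' s| ≤ ε := by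
  have hE : ∀ i x, p i x ≤ marg Prod.snd (p i) x.2 := fun i x => le_marg Prod.snd (hp i).1 x
  have hM : ∀ i (x : Ω × E), p i x ≤
      marg (fun x : Ω × E => (pr x.1, x.2)) (p i) (pr x.1, x.2) :=
    fun i x => le_marg (fun x : Ω × E => (pr x.1, x.2)) (hp i).1 x
  have hU : ∀ i s, κ i s ≤ marg Prod.fst (κ i) s.1 := fun i s => le_marg Prod.fst (hκ i).1 s
  obtain ⟨r₁, hr₁, η₁, hη₁, H₁⟩ := chernoff_pair hp hκ (c' := c') (c := c)
    (h := fun i x => Real.log (marg (fun x : Ω × E => (pr x.1, x.2)) (p i) (pr x.1, x.2)) -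
      Real.log (marg Prod.snd (p i) x.2))
    (k := fun i s => -Real.log (marg Prod.fst (κ i) s.1)) (by
      simp only [mul_sub, mul_neg, Finset.sum_sub_distrib, Finset.sum_neg_distrib] at gap₁ ⊢
      simp only [ent_marg_eq, mul_neg, Finset.sum_neg_distrib] at gap₁
      linarith)
  obtain ⟨r₂, hr₂, η₂, hη₂, H₂⟩ := chernoff_pair hp hκ (c' := c') (c := c)
    (h := fun i x => Real.log (p i x) - Real.log (marg Prod.snd (p i) x.2))
    (k := fun i s => -Real.log (κ i s)) (by
      have e1 : ∀ i, ent (p i) = -∑ x, p i x * Real.log (p i x) := fun i => by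
        rw [ent, ← Finset.sum_neg_distrib]
        exact Finset.sum_congr rfl fun b _ => by rw [Real.negMulLog]; ring
      have e2 : ∀ i, ent (κ i) = -∑ x, κ i x * Real.log (κ i x) := fun i => by
        rw [ent, ← Finset.sum_neg_distrib]
        exact Finset.sum_congr rfl fun b _ => by rw [Real.negMulLog]; ring
      simp only [mul_sub, mul_neg, Finset.sum_sub_distrib, Finset.sum_neg_distrib] at gap₂ ⊢
      simp only [ent_marg_eq, e1, e2, mul_neg, Finset.sum_neg_distrib] at gap₂
      linarith)
  have hr : 0 < min r₁ r₂ := lt_min hr₁ hr₂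
  have hη : 0 < min η₁ η₂ := lt_min hη₁ hη₂
  obtain ⟨N₀, hN₀⟩ := eventually_small hε hr hη
  refine ⟨N₀, fun N hN m m' v v' hv hv' => ?_⟩
  have hNpos : (0 : ℝ) ≤ N := Nat.cast_nonneg N
  set P : (Fin m' → U) × (Fin m' → Uh) → ℝ :=
    fun s => blockProd κ v' (fun j => (s.1 j, s.2 j)) with hPdef
  have hP : IsDist P := by
    refine ⟨fun s => blockProd_nonneg (fun i => (hκ i).1) _ _, ?_⟩
    rw [Fintype.sum_prod_type, hPdef]
    simp only
    rw [sum_arrow_prod (fun s => blockProd κ v' s), sum_blockProd_eq_one fun i => (hκ i).2]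
  set pb : (Fin m → Ω) → (Fin m → E) → ℝ := fun a e => blockProd p v (fun t => (a t, e t))
    with hpb
  have hpb0 : ∀ a e, 0 ≤ pb a e := fun a e => blockProd_nonneg (fun i => (hp i).1) _ _
  have hpb1 : ∑ a, ∑ e, pb a e = 1 := by
    rw [hpb]
    simp only
    rw [sum_arrow_prod (fun x => blockProd p v x), sum_blockProd_eq_one fun i => (hp i).2]
  have hpE : ∀ e, ∑ a, pb a e = blockProd (fun i => marg Prod.snd (p i)) v e := by
    intro e
    simp only [hpb, blockProd, marg_snd]
    rw [Fintype.prod_sum]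
  have hpM : ∀ e b, marg (fun (a : Fin m → Ω) t => pr (a t)) (fun a => pb a e) b =
      ∏ t, marg (fun x : Ω × E => (pr x.1, x.2)) (p (v t)) (b t, e t) := by
    intro e b
    simp only [marg_map_fst]
    rw [← marg_prod pr (fun t ω => p (v t) (ω, e t)) b]
    rfl
  have hPU : ∀ u, marg Prod.fst P u = ∏ j, marg Prod.fst (κ (v' j)) (u j) := by
    intro u
    simp only [hPdef, marg_fst, blockProd]
    rw [Fintype.prod_sum]
  obtain ⟨f, g, hfg, hle⟩ := exists_binning hpb0 hpb1 (fun (a : Fin m → Ω) t => pr (a t)) hP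
    (τ := Real.exp (-(min r₁ r₂ * N))) (Real.exp_nonneg _)
  refine ⟨f, g, ?_, ?_⟩
  · intro ω j
    exact Finset.prod_ne_zero_iff.1 (hfg ω) j (Finset.mem_univ j)
  have hbad : (∑ a, ∑ e, ∑ s, if BinGood pb (fun (a : Fin m → Ω) t => pr (a t)) P
        (Real.exp (-(min r₁ r₂ * N))) a e s then 0 else pb a e * P s) ≤
      2 * Real.exp (-(min η₁ η₂ * N)) := by
    have hb : ∀ (a : Fin m → Ω) (e : Fin m → E) (s : (Fin m' → U) × (Fin m' → Uh)),
        (if BinGood pb (fun (a : Fin m → Ω) t => pr (a t)) P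
          (Real.exp (-(min r₁ r₂ * N))) a e s then 0 else pb a e * P s) ≤
        (if -(r₁ * N) < ∑ t, (Real.log (marg (fun x : Ω × E => (pr x.1, x.2)) (p (v t))
              (pr (a t), e t)) - Real.log (marg Prod.snd (p (v t)) (e t))) +
            ∑ j, -Real.log (marg Prod.fst (κ (v' j)) (s.1 j))
          then pb a e * P s else 0) +
        (if -(r₂ * N) < ∑ t, (Real.log (p (v t) (a t, e t)) -
              Real.log (marg Prod.snd (p (v t)) (e t))) +
            ∑ j, -Real.log (κ (v' j) (s.1 j, s.2 j))
          then pb a e * P s else 0) := by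
      intro a e s
      have hnn : 0 ≤ pb a e * P s := mul_nonneg (hpb0 a e) (hP.1 s)
      by_cases hz : pb a e * P s = 0
      · simp [hz]
      have ha : ∀ t, 0 < p (v t) (a t, e t) := fun t => lt_of_le_of_ne ((hp _).1 _)
        (Finset.prod_ne_zero_iff.1 (left_ne_zero_of_mul hz) t (Finset.mem_univ t)).symm
      have hs : ∀ j, 0 < κ (v' j) (s.1 j, s.2 j) := fun j => lt_of_le_of_ne ((hκ _).1 _)
        (Finset.prod_ne_zero_iff.1 (right_ne_zero_of_mul hz) j (Finset.mem_univ j)).symm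
      by_cases hg : BinGood pb (fun (a : Fin m → Ω) t => pr (a t)) P
          (Real.exp (-(min r₁ r₂ * N))) a e s
      · rw [if_pos hg]
        exact add_nonneg (by split_ifs <;> simp [hnn]) (by split_ifs <;> simp [hnn])
      rw [if_neg hg]
      by_cases h1 : -(r₁ * N) < ∑ t, (Real.log (marg (fun x : Ω × E => (pr x.1, x.2)) (p (v t))
              (pr (a t), e t)) - Real.log (marg Prod.snd (p (v t)) (e t))) +
            ∑ j, -Real.log (marg Prod.fst (κ (v' j)) (s.1 j))
      · rw [if_pos h1]
        refine le_add_of_nonneg_right ?_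
        split_ifs <;> simp [hnn]
      by_cases h2 : -(r₂ * N) < ∑ t, (Real.log (p (v t) (a t, e t)) -
              Real.log (marg Prod.snd (p (v t)) (e t))) +
            ∑ j, -Real.log (κ (v' j) (s.1 j, s.2 j))
      · rw [if_pos h2]
        refine le_add_of_nonneg_left ?_
        split_ifs
        simp
      exfalso
      apply hg
      push Not at h1 h2
      have hN1 : min r₁ r₂ * N ≤ r₁ * N := mul_le_mul_of_nonneg_right (min_le_left _ _) hNpos
      have hN2 : min r₁ r₂ * N ≤ r₂ * N := mul_le_mul_of_nonneg_right (min_le_right _ _) hNpos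
      constructor
      · rw [hpM, hpE, hPU]
        exact prod_le_of_sum_log_le (fun t => (ha t).trans_le (hM _ _))
          (fun t => (ha t).trans_le (hE (v t) (a t, e t))) (fun j => (hs j).trans_le (hU _ _))
          (h1.trans (by linarith))
      · rw [hpE]
        exact prod_le_of_sum_log_le ha
          (fun t => (ha t).trans_le (hE (v t) (a t, e t))) hs (h2.trans (by linarith))
    refine (Finset.sum_le_sum fun a _ => Finset.sum_le_sum fun e _ =>
      Finset.sum_le_sum fun s _ => hb a e s).trans ?_
    simp only [Finset.sum_add_distrib]
    have hb1 := H₁ N m m' v v' hv hv'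
    have hb2 := H₂ N m m' v v' hv hv'
    rw [← sum_arrow_prod] at hb1 hb2
    simp only [← sum_arrow_prod (α := U) (β := Uh)] at hb1 hb2
    simp only [Fintype.sum_prod_type]
    have hx1 : Real.exp (-(η₁ * N)) ≤ Real.exp (-(min η₁ η₂ * N)) :=
      Real.exp_le_exp.2 (neg_le_neg (mul_le_mul_of_nonneg_right (min_le_left _ _) hNpos))
    have hx2 : Real.exp (-(η₂ * N)) ≤ Real.exp (-(min η₁ η₂ * N)) :=
      Real.exp_le_exp.2 (neg_le_neg (mul_le_mul_of_nonneg_right (min_le_right _ _) hNpos))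
    rw [two_mul]
    exact add_le_add (hb1.trans hx1) (hb2.trans hx2)
  refine le_trans (le_trans (le_of_eq ?_) hle) ((add_le_add_left
    (mul_le_mul_of_nonneg_left hbad zero_le_two) _).trans (hN₀ N hN))
  refine Finset.sum_congr rfl fun e _ => ?_
  rw [Fintype.sum_prod_type, ← sum_arrow_prod (α := U) (β := Uh)]
  refine Finset.sum_congr rfl fun u _ => Finset.sum_congr rfl fun uh _ => ?_
  rw [← hpE]
  congr 2
  simp only [marg]
  refine Finset.sum_congr rfl fun ω _ => ?_
  congr 1
  simp only [Prod.mk.injEq, funext_iff, eq_iff_iff]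
  exact forall_and

end BlockMaps

section Chaining

/-- One step of a chain: if the key `s` is almost independent of the past observation `e`, and a
block driven by an ideal key produces an almost ideal pair (observation, next key), then the
next key is almost independent of the extended observation. -/
lemma sum_abs_compose_le {E S E' S' : Type} [Fintype E] [Fintype S] [Fintype E'] [Fintype S']
    {R : E → S → ℝ} {Q : E → ℝ} {κ : S → ℝ} {K : S → E' → S' → ℝ} {Q' : E' → ℝ} {κ' : S' → ℝ}
    {ε δ : ℝ} (hQ : ∀ e, 0 ≤ Q e) (hQ1 : ∑ e, Q e = 1)
    (hK : ∀ s e s', 0 ≤ K s e s') (hK1 : ∀ s, ∑ e, ∑ s', K s e s' = 1)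
    (hR : ∑ e, ∑ s, |R e s - Q e * κ s| ≤ ε)
    (hT : ∑ e', ∑ s', |∑ s, κ s * K s e' s' - Q' e' * κ' s'| ≤ δ) :
    ∑ e, ∑ e', ∑ s', |∑ s, R e s * K s e' s' - Q e * Q' e' * κ' s'| ≤ ε + δ := by
  have hpt : ∀ e e' s', |∑ s, R e s * K s e' s' - Q e * Q' e' * κ' s'| ≤
      ∑ s, |R e s - Q e * κ s| * K s e' s' +
        Q e * |∑ s, κ s * K s e' s' - Q' e' * κ' s'| := by
    intro e e' s'
    have h1 : ∑ s, R e s * K s e' s' - Q e * Q' e' * κ' s' =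
        ∑ s, (R e s - Q e * κ s) * K s e' s' +
          Q e * (∑ s, κ s * K s e' s' - Q' e' * κ' s') := by
      simp only [sub_mul, Finset.sum_sub_distrib, mul_sub, Finset.mul_sum, mul_assoc]
      ring
    rw [h1]
    refine (abs_add_le _ _).trans (add_le_add ?_ (by rw [abs_mul, abs_of_nonneg (hQ e)]))
    refine (Finset.abs_sum_le_sum_abs _ _).trans (Finset.sum_le_sum fun s _ => ?_)
    rw [abs_mul, abs_of_nonneg (hK _ _ _)]
  calc _ ≤ ∑ e, ∑ e', ∑ s', (∑ s, |R e s - Q e * κ s| * K s e' s' +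
        Q e * |∑ s, κ s * K s e' s' - Q' e' * κ' s'|) :=
        Finset.sum_le_sum fun e _ => Finset.sum_le_sum fun e' _ =>
          Finset.sum_le_sum fun s' _ => hpt e e' s'
    _ = ∑ e, ∑ s, |R e s - Q e * κ s| +
        ∑ e', ∑ s', |∑ s, κ s * K s e' s' - Q' e' * κ' s'| := by
        simp only [Finset.sum_add_distrib]
        congr 1
        · refine Finset.sum_congr rfl fun e _ => ?_
          calc _ = ∑ s, ∑ e', ∑ s', |R e s - Q e * κ s| * K s e' s' := by
                rw [Finset.sum_comm (s := (Finset.univ : Finset S))]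
                exact Finset.sum_congr rfl fun e' _ => Finset.sum_comm
            _ = _ := by
                simp only [← Finset.mul_sum, hK1, mul_one]
        · simp only [← Finset.mul_sum]
          rw [← Finset.sum_mul, hQ1, one_mul]
    _ ≤ _ := add_le_add hR hT

end Chaining

section Codes

lemma castAdd_lt_natAdd {n m : ℕ} (j : Fin m) (t : Fin n) : t.castAdd m < j.natAdd n := by
  rw [Fin.lt_def, Fin.val_castAdd, Fin.val_natAdd]; omega

/-- Kernels of a round, indexed by a letter type `i`, with the law of the pair of keys it uses. -/
structure LetterFamily (ι U Uh X Y Z B : Type) [Fintype U] [Fintype Uh] [Fintype Y] [Fintype Z]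
    [Fintype B] where
  key : ι → U × Uh → ℝ
  enc : ι → X → U × Uh → B → ℝ
  decY : ι → B → U × Uh → Y → ℝ
  decZ : ι → B → U → Z → ℝ
  key_dist : ∀ i, IsDist (key i)
  enc_dist : ∀ i x s, IsDist (enc i x s)
  decY_dist : ∀ i b s, IsDist (decY i b s)
  decZ_dist : ∀ i b u, IsDist (decZ i b u)

variable {ι U Uh W Wh X Y Z B : Type} [Fintype U] [Fintype Uh] [Fintype W] [Fintype Wh]
  [Fintype X] [Fintype Y] [Fintype Z] [Fintype B]

namespace LetterFamily

variable (L : LetterFamily ι U Uh X Y Z B) (πX : X → ℝ) (PW : W → ℝ) (PWh : Wh → ℝ)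

/-- Law of a round of type `i` given the keys. -/
def round (i : ι) (s : U × Uh) (a : W × Wh × B) (e : X × Y × Z) : ℝ :=
  πX e.1 * PW a.1 * PWh a.2.1 * L.enc i e.1 s a.2.2 * L.decY i a.2.2 s e.2.1 *
    L.decZ i a.2.2 s.1 e.2.2

/-- Joint law of a round of type `i` and its keys. -/
def law (i : ι) (x : ((W × Wh × B) × (U × Uh)) × (X × Y × Z)) : ℝ :=
  L.key i x.1.2 * L.round πX PW PWh i x.1.2 x.1.1 x.2

variable {πX PW PWh} (hX : IsDist πX) (hW : IsDist PW) (hWh : IsDist PWh)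

include hX hW hWh

lemma round_nonneg (i : ι) (s : U × Uh) (a : W × Wh × B) (e : X × Y × Z) :
    0 ≤ L.round πX PW PWh i s a e :=
  mul_nonneg (mul_nonneg (mul_nonneg (mul_nonneg (mul_nonneg (hX.1 _) (hW.1 _)) (hWh.1 _))
    ((L.enc_dist _ _ _).1 _)) ((L.decY_dist _ _ _).1 _)) ((L.decZ_dist _ _ _).1 _)

lemma sum_round (i : ι) (s : U × Uh) :
    ∑ a, ∑ e, L.round πX PW PWh i s a e = 1 := by
  have h : ∀ a : W × Wh × B, ∑ e, L.round πX PW PWh i s a e =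
      PW a.1 * (PWh a.2.1 * ∑ x, πX x * L.enc i x s a.2.2) := fun a => by
    simp only [Fintype.sum_prod_type, round, ← Finset.mul_sum, (L.decZ_dist _ _ _).2,
      (L.decY_dist _ _ _).2, mul_one]
    rw [Finset.mul_sum, Finset.mul_sum]
    exact Finset.sum_congr rfl fun x _ => by ring
  simp only [h, Fintype.sum_prod_type, ← Finset.mul_sum]
  rw [Finset.sum_comm]
  simp only [← Finset.mul_sum, (L.enc_dist _ _ _).2, mul_one, hX.2, hW.2, hWh.2]

lemma isDist_law (i : ι) : IsDist (L.law πX PW PWh i) := by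
  refine ⟨fun x => mul_nonneg ((L.key_dist i).1 _) (L.round_nonneg hX hW hWh _ _ _ _), ?_⟩
  rw [Fintype.sum_prod_type, Fintype.sum_prod_type, Finset.sum_comm]
  simp only [law, ← Finset.mul_sum, L.sum_round hX hW hWh, mul_one]
  exact (L.key_dist i).2

end LetterFamily

namespace BCode

variable {n m m' : ℕ}

/-- Joint law of the inner variables and the observations under a code. -/
def joint (C : BCode W Wh X Y Z B n) (πX : X → ℝ) (PW : W → ℝ) (PWh : Wh → ℝ)
    (a : Fin n → W × Wh × B) (e : Fin n → X × Y × Z) : ℝ :=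
  (∏ k, πX (e k).1) * (∏ k, PW (a k).1) * (∏ k, PWh (a k).2.1) *
    (∏ k, C.enc k (fun t => (a t).1) (fun t => (a t).2.1) (fun t => (e t).1)
      (fun t => (a t).2.2) (a k).2.2) *
    (∏ k, C.decY k (fun t => (a t).1) (fun t => (a t).2.1) (fun t => (a t).2.2)
      (fun t => (e t).2.1) (e k).2.1) *
    ∏ k, C.decZ k (fun t => (a t).1) (fun t => (a t).2.2) (fun t => (e t).2.2) (e k).2.2

/-- Keys computed from the inner variables. -/
def keys (φ : (Fin n → W × B) → Fin m → U) (φh : (Fin n → W × Wh × B) → Fin m → Uh)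
    (a : Fin n → W × Wh × B) (j : Fin m) : U × Uh :=
  (φ (fun t => ((a t).1, (a t).2.2)) j, φh a j)

/-- Append to a code a block of rounds of types `v`, with keys computed from the first rounds. -/
def extend (C : BCode W Wh X Y Z B n) (L : LetterFamily ι U Uh X Y Z B) (v : Fin m → ι)
    (φ : (Fin n → W × B) → Fin m → U) (φh : (Fin n → W × Wh × B) → Fin m → Uh) :
    BCode W Wh X Y Z B (n + m) where
  enc := Fin.addCases
    (fun i w wh x b => C.enc i (fun t => w (t.castAdd m)) (fun t => wh (t.castAdd m))
      (fun t => x (t.castAdd m)) (fun t => b (t.castAdd m)))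
    (fun j w wh x b => L.enc (v j) (x (j.natAdd n)) (keys φ φh (fun t =>
      (w (t.castAdd m), wh (t.castAdd m), b (t.castAdd m))) j))
  decY := Fin.addCases
    (fun i w wh b y => C.decY i (fun t => w (t.castAdd m)) (fun t => wh (t.castAdd m))
      (fun t => b (t.castAdd m)) (fun t => y (t.castAdd m)))
    (fun j w wh b _ => L.decY (v j) (b (j.natAdd n)) (keys φ φh (fun t =>
      (w (t.castAdd m), wh (t.castAdd m), b (t.castAdd m))) j))
  decZ := Fin.addCases
    (fun i w b z => C.decZ i (fun t => w (t.castAdd m)) (fun t => b (t.castAdd m))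
      (fun t => z (t.castAdd m)))
    (fun j w b _ => L.decZ (v j) (b (j.natAdd n)) (φ (fun t =>
      (w (t.castAdd m), b (t.castAdd m))) j))
  enc_dist k w wh x b := by
    induction k using Fin.addCases with
    | left i => simpa using C.enc_dist _ _ _ _ _
    | right j => simpa using L.enc_dist _ _ _
  decY_dist k w wh b y := by
    induction k using Fin.addCases with
    | left i => simpa using C.decY_dist _ _ _ _ _
    | right j => simpa using L.decY_dist _ _ _
  decZ_dist k w b z := by
    induction k using Fin.addCases with
    | left i => simpa using C.decZ_dist _ _ _ _
    | right j => simpa using L.decZ_dist _ _ _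
  enc_causal k w w' wh wh' x x' b b' h1 h2 h3 h4 := by
    induction k using Fin.addCases with
    | left i =>
      simp only [Fin.addCases_left]
      exact C.enc_causal _ _ _ _ _ _ _ _ _ (fun t ht => h1 _ ht)
        (fun t ht => h2 _ ht) (fun t ht => h3 _ ht)
        (fun t ht => h4 _ ht)
    | right j =>
      have hlt : ∀ t : Fin n, t.castAdd m < j.natAdd n := castAdd_lt_natAdd j
      simp only [Fin.addCases_right, fun t => h1 _ (hlt t).le, fun t => h2 _ (hlt t).le,
        h3 _ le_rfl, fun t => h4 _ (hlt t)]
  decY_causal k w w' wh wh' b b' y y' h1 h2 h3 h4 := by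
    induction k using Fin.addCases with
    | left i =>
      simp only [Fin.addCases_left]
      exact C.decY_causal _ _ _ _ _ _ _ _ _ (fun t ht => h1 _ ht)
        (fun t ht => h2 _ ht) (fun t ht => h3 _ ht)
        (fun t ht => h4 _ ht)
    | right j =>
      have hlt : ∀ t : Fin n, t.castAdd m < j.natAdd n := castAdd_lt_natAdd j
      simp only [Fin.addCases_right, fun t => h1 _ (hlt t).le, fun t => h2 _ (hlt t).le,
        h3 _ le_rfl, fun t => h3 _ (hlt t).le]
  decZ_causal k w w' b b' z z' h1 h2 h3 := by
    induction k using Fin.addCases with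
    | left i =>
      simp only [Fin.addCases_left]
      exact C.decZ_causal _ _ _ _ _ _ _ (fun t ht => h1 _ ht)
        (fun t ht => h2 _ ht) (fun t ht => h3 _ ht)
    | right j =>
      have hlt : ∀ t : Fin n, t.castAdd m < j.natAdd n := castAdd_lt_natAdd j
      simp only [Fin.addCases_right, fun t => h1 _ (hlt t).le, h2 _ le_rfl,
        fun t => h2 _ (hlt t).le]

lemma joint_extend (C : BCode W Wh X Y Z B n) (L : LetterFamily ι U Uh X Y Z B) (v : Fin m → ι)
    (φ : (Fin n → W × B) → Fin m → U) (φh : (Fin n → W × Wh × B) → Fin m → Uh)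
    (πX : X → ℝ) (PW : W → ℝ) (PWh : Wh → ℝ) (a : Fin n → W × Wh × B)
    (a' : Fin m → W × Wh × B) (e : Fin n → X × Y × Z) (e' : Fin m → X × Y × Z) :
    (C.extend L v φ φh).joint πX PW PWh (Fin.append a a') (Fin.append e e') =
      C.joint πX PW PWh a e * ∏ j, L.round πX PW PWh (v j) (keys φ φh a j) (a' j) (e' j) := by
  simp only [joint, extend, Fin.prod_univ_add, Fin.append_left, Fin.append_right,
    Fin.addCases_left, Fin.addCases_right, LetterFamily.round, Finset.prod_mul_distrib, keys]
  ring

end BCode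

end Codes

section Reach

lemma sum_append {α : Type} [Fintype α] {n m : ℕ} (F : (Fin (n + m) → α) → ℝ) :
    ∑ x, F x = ∑ a : Fin n → α, ∑ b : Fin m → α, F (Fin.append a b) := by
  rw [← Fintype.sum_prod_type' (f := fun (a : Fin n → α) (b : Fin m → α) => F (Fin.append a b))]
  exact (Equiv.sum_comp (Fin.appendEquiv n m) F).symm

lemma blockProd_append {ι Ω : Type} (p : ι → Ω → ℝ) {n m : ℕ} (v : Fin n → ι) (v' : Fin m → ι)
    (ω : Fin n → Ω) (ω' : Fin m → Ω) :
    blockProd p (Fin.append v v') (Fin.append ω ω') = blockProd p v ω * blockProd p v' ω' := by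
  simp [blockProd, Fin.prod_univ_add]

variable {ι U Uh W Wh X Y Z B : Type} [Fintype U] [Fintype Uh] [Fintype W] [Fintype Wh]
  [Fintype X] [Fintype Y] [Fintype Z] [Fintype B]

/-- Law of the observation in a round of type `i`. -/
def LetterFamily.obs (L : LetterFamily ι U Uh X Y Z B) (πX : X → ℝ) (PW : W → ℝ) (PWh : Wh → ℝ)
    (i : ι) : X × Y × Z → ℝ :=
  marg Prod.snd (L.law πX PW PWh i)

/-- Some code produces observations of types `vv` together with keys for a block of types `v`,
up to total variation `ε`. -/
def Reach (L : LetterFamily ι U Uh X Y Z B) (πX : X → ℝ) (PW : W → ℝ) (PWh : Wh → ℝ) {n m : ℕ}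
    (vv : Fin n → ι) (v : Fin m → ι) (ε : ℝ) : Prop :=
  ∃ (C : BCode W Wh X Y Z B n) (φ : (Fin n → W × B) → Fin m → U)
    (φh : (Fin n → W × Wh × B) → Fin m → Uh),
    (∑ e, ∑ s, |marg (BCode.keys φ φh) (fun a => C.joint πX PW PWh a e) s -
      blockProd (L.obs πX PW PWh) vv e * blockProd L.key v s| ≤ ε) ∧
    ∀ e s, blockProd (L.obs πX PW PWh) vv e * blockProd L.key v s = 0 →
      marg (BCode.keys φ φh) (fun a => C.joint πX PW PWh a e) s = 0

variable {L : LetterFamily ι U Uh X Y Z B} {πX : X → ℝ} {PW : W → ℝ} {PWh : Wh → ℝ}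

lemma reach_zero {i : ι} {s₀ : U × Uh} (h1 : ∀ s, L.key i s = ind s₀ s) (m : ℕ) :
    Reach L πX PW PWh Fin.elim0 (fun _ : Fin m => i) 0 := by
  let C : BCode W Wh X Y Z B 0 :=
    { enc := fun k => k.elim0, decY := fun k => k.elim0, decZ := fun k => k.elim0
      enc_dist := fun k => k.elim0, decY_dist := fun k => k.elim0, decZ_dist := fun k => k.elim0
      enc_causal := fun k => k.elim0, decY_causal := fun k => k.elim0
      decZ_causal := fun k => k.elim0 }
  have key : ∀ e s, marg (BCode.keys (n := 0) (W := W) (Wh := Wh) (B := B) (fun _ _ => s₀.1)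
      (fun _ (_ : Fin m) => s₀.2)) (fun a => C.joint πX PW PWh a e) s =
      blockProd (L.obs πX PW PWh) Fin.elim0 e * blockProd L.key (fun _ : Fin m => i) s := by
    intro e s
    have hk : ∀ a : Fin 0 → W × Wh × B, BCode.keys (fun _ _ => s₀.1)
      (fun _ (_ : Fin m) => s₀.2) a = fun _ => s₀ := fun a => rfl
    simp only [marg, hk, BCode.joint, blockProd, h1, Finset.univ_unique, Finset.prod_empty,
      Finset.univ_eq_empty, mul_one, Finset.sum_singleton, one_mul]
    split_ifs with h
    · subst h; simp [ind]
    · obtain ⟨t, ht⟩ := Function.ne_iff.1 h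
      exact (Finset.prod_eq_zero (Finset.mem_univ t) (by simp [ind, ht])).symm
  exact ⟨C, _, _, le_of_eq (Finset.sum_eq_zero fun e _ => Finset.sum_eq_zero fun s _ => by
    rw [key, sub_self, abs_zero]), fun e s h => by rw [key, h]⟩

lemma sum_abs_marg_append {n m : ℕ} {S : Type} [Fintype S] (G H : (Fin (n + m) → X) → S → ℝ) :
    ∑ e, ∑ s, |G e s - H e s| = ∑ e, ∑ e', ∑ s, |G (Fin.append e e') s -
      H (Fin.append e e') s| :=
  sum_append fun e => ∑ s, |G e s - H e s|

variable (hX : IsDist πX) (hW : IsDist PW) (hWh : IsDist PWh)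

include hX hW hWh

lemma Reach.append {n m m' : ℕ} {vv : Fin n → ι} {v : Fin m → ι} {v' : Fin m' → ι} {ε δ : ℝ}
    (h : Reach L πX PW PWh vv v ε)
    {f : (Fin m → W × B × U) → Fin m' → U}
    {g : (Fin m → (W × Wh × B) × (U × Uh)) → Fin m' → Uh}
    (hsupp : ∀ ω j, L.key (v' j) (f (fun t => ((ω t).1.1, (ω t).1.2.2, (ω t).2.1)) j, g ω j) ≠ 0)
    (hT : ∑ e, ∑ s, |marg (fun ω j => (f (fun t => ((ω t).1.1, (ω t).1.2.2, (ω t).2.1)) j, g ω j))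
      (fun ω => blockProd (L.law πX PW PWh) v (fun t => (ω t, e t))) s -
        blockProd (L.obs πX PW PWh) v e * blockProd L.key v' s| ≤ δ) :
    Reach L πX PW PWh (Fin.append vv v) v' (ε + δ) := by
  obtain ⟨C, φ, φh, hR, hac⟩ := h
  set F : (Fin m → W × Wh × B) → (Fin m → U × Uh) → Fin m' → U × Uh := fun a s j =>
    (f (fun t => ((a t).1, (a t).2.2, (s t).1)) j, g (fun t => (a t, s t)) j) with hF
  set K : (Fin m → U × Uh) → (Fin m → X × Y × Z) → (Fin m' → U × Uh) → ℝ := fun s e' s' =>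
    marg (fun a => F a s) (fun a => ∏ j, L.round πX PW PWh (v j) (s j) (a j) (e' j)) s' with hK
  have hrn : ∀ (s : Fin m → U × Uh) (a : Fin m → W × Wh × B) (e' : Fin m → X × Y × Z),
      0 ≤ ∏ j : Fin m, L.round πX PW PWh (v j) (s j) (a j) (e' j) :=
    fun s a e' => Finset.prod_nonneg fun j _ => L.round_nonneg hX hW hWh _ _ _ _
  have hK0 : ∀ s e' s', 0 ≤ K s e' s' := fun s e' s' => marg_nonneg _ (fun a => hrn s a e') _
  have hK1 : ∀ s, ∑ e', ∑ s', K s e' s' = 1 := by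
    intro s
    simp only [hK, sum_marg]
    rw [Finset.sum_comm, sum_arrow_prod (fun x : Fin m → (W × Wh × B) × (X × Y × Z) =>
      ∏ j, L.round πX PW PWh (v j) (s j) (x j).1 (x j).2), ← Fintype.prod_sum
        (fun j (x : (W × Wh × B) × (X × Y × Z)) => L.round πX PW PWh (v j) (s j) x.1 x.2)]
    refine Finset.prod_eq_one fun j _ => ?_
    rw [Fintype.sum_prod_type]
    exact L.sum_round hX hW hWh _ _
  have hTK : ∀ e' s', marg (fun ω j => (f (fun t => ((ω t).1.1, (ω t).1.2.2, (ω t).2.1)) j, g ω j))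
      (fun ω => blockProd (L.law πX PW PWh) v (fun t => (ω t, e' t))) s' =
      ∑ s, blockProd L.key v s * K s e' s' := by
    intro e' s'
    simp only [hK, marg]
    rw [← sum_arrow_prod, Finset.sum_comm]
    refine Finset.sum_congr rfl fun s _ => ?_
    rw [Finset.mul_sum]
    refine Finset.sum_congr rfl fun a _ => ?_
    rw [mul_ite, mul_zero]
    simp only [blockProd, LetterFamily.law, Finset.prod_mul_distrib, hF]
  simp only [hTK] at hT
  refine ⟨C.extend L v φ φh,
    fun wb => f fun t => ((wb (t.natAdd n)).1, (wb (t.natAdd n)).2,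
      φ (fun t => wb (t.castAdd m)) t),
    fun a => g fun t => (a (t.natAdd n), BCode.keys φ φh (fun t => a (t.castAdd m)) t), ?_⟩
  have hstep : ∀ e e' s', marg (BCode.keys
      (fun wb => f fun t => ((wb (t.natAdd n)).1, (wb (t.natAdd n)).2,
        φ (fun t => wb (t.castAdd m)) t))
      (fun a => g fun t => (a (t.natAdd n), BCode.keys φ φh (fun t => a (t.castAdd m)) t)))
      (fun a => (C.extend L v φ φh).joint πX PW PWh a (Fin.append e e')) s' =
      ∑ s, marg (BCode.keys φ φh) (fun a => C.joint πX PW PWh a e) s * K s e' s' := by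
    intro e e' s'
    rw [sum_marg_mul (BCode.keys φ φh) _ (fun s => K s e' s'), marg, sum_append]
    refine Finset.sum_congr rfl fun a _ => ?_
    simp only [hK, marg]
    rw [Finset.mul_sum]
    refine Finset.sum_congr rfl fun a' _ => ?_
    rw [BCode.joint_extend, mul_ite, mul_zero]
    congr 1
    refine congrArg (· = s') (funext fun j => ?_)
    simp only [BCode.keys, hF, Fin.append_left, Fin.append_right]
  have hobs : ∀ i, IsDist (L.obs πX PW PWh i) := fun i =>
    ⟨fun b => marg_nonneg _ (L.isDist_law hX hW hWh i).1 b, by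
      rw [LetterFamily.obs, sum_marg]; exact (L.isDist_law hX hW hWh i).2⟩
  constructor
  · rw [sum_abs_marg_append]
    simp only [hstep, blockProd_append]
    exact sum_abs_compose_le (isDist_blockProd hobs vv).1 (isDist_blockProd hobs vv).2 hK0 hK1 hR hT
  · intro e s' h0
    obtain ⟨⟨e₁, e₂⟩, rfl⟩ := (Fin.appendEquiv n m).surjective e
    change blockProd _ _ (Fin.append e₁ e₂) * _ = 0 at h0
    change marg _ (fun a => (C.extend L v φ φh).joint πX PW PWh a (Fin.append e₁ e₂)) s' = 0
    rw [blockProd_append] at h0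
    rw [hstep]
    refine Finset.sum_eq_zero fun s _ => ?_
    by_contra hne
    have hR0 : blockProd (L.obs πX PW PWh) vv e₁ * blockProd L.key v s ≠ 0 := fun h =>
      hne (by rw [hac _ _ h, zero_mul])
    have hKne : K s e₂ s' ≠ 0 := fun h => hne (by rw [h, mul_zero])
    rcases mul_eq_zero.1 h0 with h0 | h0
    · rcases mul_eq_zero.1 h0 with h0 | h0
      · exact hR0 (by rw [h0, zero_mul])
      · refine hKne (Finset.sum_eq_zero fun a _ => ?_)
        split_ifs
        · obtain ⟨j, -, hj⟩ := Finset.prod_eq_zero_iff.1 h0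
          refine Finset.prod_eq_zero (Finset.mem_univ j) ?_
          have h2 := le_marg Prod.snd (L.isDist_law hX hW hWh (v j)).1 ((a j, s j), e₂ j)
          have h3 : marg Prod.snd (L.law πX PW PWh (v j)) (e₂ j) = 0 := hj
          have h4 : L.key (v j) (s j) ≠ 0 :=
            Finset.prod_ne_zero_iff.1 (right_ne_zero_of_mul hR0) j (Finset.mem_univ j)
          have h5 := (h2.trans_eq h3).antisymm ((L.isDist_law hX hW hWh (v j)).1 _)
          exact (mul_eq_zero.1 h5).resolve_left h4
        · rfl
    · refine hKne (Finset.sum_eq_zero fun a _ => ?_)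
      split_ifs with hFs
      · obtain ⟨j, -, hj⟩ := Finset.prod_eq_zero_iff.1 h0
        refine absurd ?_ (hsupp (fun t => (a t, s t)) j)
        rw [← hj, ← hFs]
      · rfl

end Reach

section Divergence

lemma mul_log_div_le {J Q T M : ℝ} (hJ : 0 ≤ J) (hQ : 0 ≤ Q) (hM : 0 ≤ M) (hJ2 : J ≤ 2)
    (h0 : Q = 0 → J = 0) (hlog : Q ≠ 0 → |Real.log Q| ≤ M)
    (hT : Q ≠ 0 → T ≠ 0) (hlogT : Q ≠ 0 → |Real.log (Q / T)| ≤ M) :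
    J * Real.log (J / T) ≤ Q * Real.log (Q / T) + |J - Q| * (2 + 2 * M) := by
  by_cases hQ0 : Q = 0
  · simp [hQ0, h0 hQ0]
  have hQpos : 0 < Q := lt_of_le_of_ne hQ (Ne.symm hQ0)
  have h1 := abs_le.1 (hlog hQ0)
  have h2 := abs_le.1 (hlogT hQ0)
  have hd := abs_nonneg (J - Q)
  by_cases hJ0 : J = 0
  · subst hJ0
    rw [zero_mul, zero_sub, abs_neg, abs_of_pos hQpos]
    nlinarith [h2.1]
  have hJpos : 0 < J := lt_of_le_of_ne hJ (Ne.symm hJ0)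
  have hsplit : Real.log (J / T) = Real.log (J / Q) + Real.log (Q / T) := by
    rw [Real.log_div hJ0 (hT hQ0), Real.log_div hJ0 hQ0, Real.log_div hQ0 (hT hQ0)]; ring
  have hA : J * Real.log (J / Q) ≤ |J - Q| * (2 + M) := by
    rcases le_total J Q with hle | hle
    · exact (mul_nonpos_of_nonneg_of_nonpos hJ (Real.log_nonpos (by positivity)
        ((div_le_one hQpos).2 hle))).trans (by positivity)
    · rw [abs_of_nonneg (sub_nonneg.2 hle)]
      have h3 : Q * Real.log (J / Q) ≤ J - Q := by
        have := mul_le_mul_of_nonneg_left (Real.log_le_sub_one_of_pos (div_pos hJpos hQpos)) hQ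
        rwa [mul_sub, mul_div_cancel₀ _ hQ0, mul_one] at this
      have h4 : Real.log (J / Q) ≤ 1 + M := by
        rw [Real.log_div hJ0 hQ0]
        linarith [Real.log_le_sub_one_of_pos hJpos, h1.1]
      nlinarith [mul_le_mul_of_nonneg_left h4 (sub_nonneg.2 hle)]
  have hB : (J - Q) * Real.log (Q / T) ≤ |J - Q| * M :=
    (le_abs_self _).trans (by
      rw [abs_mul]; exact mul_le_mul_of_nonneg_left (hlogT hQ0) hd)
  rw [hsplit]
  nlinarith

lemma sum_blockProd_mul_sum {ι Ω : Type} [Fintype Ω] {p : ι → Ω → ℝ} (hp : ∀ i, IsDist (p i))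
    (h : ι → Ω → ℝ) {m : ℕ} (v : Fin m → ι) :
    ∑ ω, blockProd p v ω * ∑ t, h (v t) (ω t) = ∑ t, ∑ ω, p (v t) ω * h (v t) ω := by
  simp only [Finset.mul_sum]
  rw [Finset.sum_comm]
  refine Finset.sum_congr rfl fun t _ => ?_
  have h1 : ∀ ω : Fin m → Ω, blockProd p v ω * h (v t) (ω t) =
      ∏ t', p (v t') (ω t') * (if t' = t then h (v t') (ω t') else 1) := fun ω => by
    rw [Finset.prod_mul_distrib, Finset.prod_ite_eq' Finset.univ t, if_pos (Finset.mem_univ t),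
      blockProd]
  simp only [h1]
  rw [← Fintype.prod_sum (fun t' ω => p (v t') ω * (if t' = t then h (v t') ω else 1)),
    Finset.prod_eq_single t (fun t' _ ht' => by simp [ht', (hp _).2]) (by simp)]
  simp

variable {ι U Uh W Wh X Y Z B : Type} [Fintype U] [Fintype Uh] [Fintype W] [Fintype Wh]
  [Fintype X] [Fintype Y] [Fintype Z] [Fintype B]

lemma BCode.joint_nonneg {n : ℕ} (C : BCode W Wh X Y Z B n) {πX : X → ℝ} {PW : W → ℝ}
    {PWh : Wh → ℝ} (hX : IsDist πX) (hW : IsDist PW) (hWh : IsDist PWh)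
    (a : Fin n → W × Wh × B) (e : Fin n → X × Y × Z) : 0 ≤ C.joint πX PW PWh a e := by
  have h1 : 0 ≤ ∏ k, πX (e k).1 := Finset.prod_nonneg fun _ _ => hX.1 _
  have h2 : 0 ≤ ∏ k, PW (a k).1 := Finset.prod_nonneg fun _ _ => hW.1 _
  have h3 : 0 ≤ ∏ k, PWh (a k).2.1 := Finset.prod_nonneg fun _ _ => hWh.1 _
  exact mul_nonneg (mul_nonneg (mul_nonneg (mul_nonneg (mul_nonneg h1 h2) h3)
    (Finset.prod_nonneg fun _ _ => (C.enc_dist _ _ _ _ _).1 _))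
    (Finset.prod_nonneg fun _ _ => (C.decY_dist _ _ _ _ _).1 _))
    (Finset.prod_nonneg fun _ _ => (C.decZ_dist _ _ _ _).1 _)

lemma BCode.sum_joint {n : ℕ} (C : BCode W Wh X Y Z B n) (πX : X → ℝ) (PW : W → ℝ)
    (PWh : Wh → ℝ) (e : Fin n → X × Y × Z) :
    ∑ a, C.joint πX PW PWh a e = (∏ k, πX (e k).1) *
      C.channel PW PWh (fun t => (e t).1) (fun t => (e t).2.1) (fun t => (e t).2.2) := by
  rw [← sum_arrow_prod, BCode.channel, Finset.mul_sum]
  refine Finset.sum_congr rfl fun w _ => ?_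
  rw [← sum_arrow_prod (fun x : Fin n → Wh × B => C.joint πX PW PWh (fun t => (w t, x t)) e),
    Finset.mul_sum]
  refine Finset.sum_congr rfl fun wh _ => ?_
  rw [Finset.mul_sum]
  refine Finset.sum_congr rfl fun b _ => ?_
  simp only [BCode.joint]
  ring

/-- Sequences of triples as triples of sequences. -/
def seqEquiv (X Y Z : Type) (n : ℕ) :
    (Fin n → X × Y × Z) ≃ (Fin n → X) × (Fin n → Y) × (Fin n → Z) where
  toFun e := (fun t => (e t).1, fun t => (e t).2.1, fun t => (e t).2.2)
  invFun p t := (p.1 t, p.2.1 t, p.2.2 t)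
  left_inv _ := rfl
  right_inv _ := rfl

variable {L : LetterFamily ι U Uh X Y Z B} {PW : W → ℝ} {PWh : Wh → ℝ} {π : X × Y × Z → ℝ}

lemma Reach.bGammaN_le (hX : IsDist (marg (fun q : X × Y × Z => q.1) π))
    (hW : IsDist PW) (hWh : IsDist PWh)
    {n m : ℕ} {vv : Fin n → ι} {v : Fin m → ι} {ε c : ℝ} (hε : ε ≤ 1)
    (h : Reach L (marg (fun q : X × Y × Z => q.1) π) PW PWh vv v ε) (hc : 0 ≤ c)
    (hac : ∀ i e, π e = 0 → L.obs (marg (fun q : X × Y × Z => q.1) π) PW PWh i e = 0)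
    (hlog : ∀ i e, |Real.log (L.obs (marg (fun q : X × Y × Z => q.1) π) PW PWh i e)| ≤ c)
    (hlogπ : ∀ i e, |Real.log (L.obs (marg (fun q : X × Y × Z => q.1) π) PW PWh i e / π e)| ≤ c) :
    BGammaN W Wh X Y Z B PW PWh π n ≤ ENNReal.ofReal
      (∑ t, (∑ e, L.obs (marg (fun q : X × Y × Z => q.1) π) PW PWh (vv t) e *
        Real.log (L.obs (marg (fun q : X × Y × Z => q.1) π) PW PWh (vv t) e / π e)) +
        ε * (2 + 2 * (n * c))) := by
  set πX := marg (fun q : X × Y × Z => q.1) π with hπX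
  set p := L.obs πX PW PWh with hp
  obtain ⟨C, φ, φh, hR, hR0⟩ := h
  have hpd : ∀ i, IsDist (p i) := fun i =>
    ⟨fun b => marg_nonneg _ (L.isDist_law hX hW hWh i).1 b, by
      rw [hp, LetterFamily.obs, sum_marg]; exact (L.isDist_law hX hW hWh i).2⟩
  set J : (Fin n → X × Y × Z) → ℝ := fun e => ∑ a, C.joint πX PW PWh a e with hJ
  set Q := blockProd p vv with hQ
  set T : (Fin n → X × Y × Z) → ℝ := fun e => ∏ t, π (e t) with hT
  have hJ0 : ∀ e, 0 ≤ J e := fun e => Finset.sum_nonneg fun a _ => C.joint_nonneg hX hW hWh a e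
  have hQ0 := (isDist_blockProd hpd vv).1
  have hJR : ∀ e, J e = ∑ s, marg (BCode.keys φ φh) (fun a => C.joint πX PW PWh a e) s :=
    fun e => (sum_marg _ _).symm
  have hJQ0 : ∀ e, Q e = 0 → J e = 0 := fun e he => by
    rw [hJR]; exact Finset.sum_eq_zero fun s _ => hR0 e s (by rw [he, zero_mul])
  have hTV : ∑ e, |J e - Q e| ≤ ε := by
    refine le_trans (Finset.sum_le_sum fun e _ => ?_) hR
    refine le_trans (le_of_eq ?_) (Finset.abs_sum_le_sum_abs _ _)
    rw [Finset.sum_sub_distrib, ← hJR, ← Finset.mul_sum,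
      (isDist_blockProd L.key_dist v).2, mul_one]
  have hQ1 : ∀ e, Q e ≤ 1 := fun e =>
    (Finset.single_le_sum (fun e _ => hQ0 e) (Finset.mem_univ e)).trans_eq
      (isDist_blockProd hpd vv).2
  have hJ2 : ∀ e, J e ≤ 2 := fun e => by
    have h1 := Finset.single_le_sum (f := fun e => |J e - Q e|) (fun e _ => abs_nonneg _)
      (Finset.mem_univ e)
    have h2 := le_abs_self (J e - Q e)
    have := hQ1 e
    linarith
  have hfac : ∀ e, Q e ≠ 0 → ∀ t, p (vv t) (e t) ≠ 0 := fun e he t =>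
    Finset.prod_ne_zero_iff.1 he t (Finset.mem_univ t)
  have hQT : ∀ e, Q e ≠ 0 → T e ≠ 0 := fun e he =>
    Finset.prod_ne_zero_iff.2 fun t _ h0 => hfac e he t (hac _ _ h0)
  have hnc : ∀ z : Fin n → ℝ, (∀ t, |z t| ≤ c) → |∑ t, z t| ≤ n * c := fun z hz =>
    (Finset.abs_sum_le_sum_abs _ _).trans ((Finset.sum_le_card_nsmul _ _ c fun t _ => hz t).trans
      (by simp))
  have hlogQT : ∀ e, Q e ≠ 0 → Real.log (Q e / T e) =
      ∑ t, Real.log (p (vv t) (e t) / π (e t)) := fun e he => by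
    rw [hQ, hT, blockProd, ← Finset.prod_div_distrib, Real.log_prod]
    exact fun t _ => div_ne_zero (hfac e he t) fun h0 => hfac e he t (hac _ _ h0)
  have hpt : ∀ e, J e * Real.log (J e / T e) ≤ Q e * Real.log (Q e / T e) +
      |J e - Q e| * (2 + 2 * (n * c)) := fun e =>
    mul_log_div_le (hJ0 e) (hQ0 e) (by positivity) (hJ2 e) (hJQ0 e)
      (fun he => by
        rw [hQ, blockProd, Real.log_prod fun t _ => hfac e he t]
        exact hnc _ fun t => hlog _ _) (hQT e)
      (fun he => by rw [hlogQT e he]; exact hnc _ fun t => hlogπ _ _)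
  have hsum : ∑ e, J e * Real.log (J e / T e) ≤
      ∑ t, (∑ e, p (vv t) e * Real.log (p (vv t) e / π e)) + ε * (2 + 2 * (n * c)) := by
    refine (Finset.sum_le_sum fun e _ => hpt e).trans ?_
    rw [Finset.sum_add_distrib, ← Finset.sum_mul]
    refine add_le_add (le_of_eq ?_) (mul_le_mul_of_nonneg_right hTV (by positivity))
    rw [← sum_blockProd_mul_sum hpd fun i e => Real.log (p i e / π e)]
    refine Finset.sum_congr rfl fun e _ => ?_
    by_cases he : Q e = 0
    · rw [he, zero_mul]; rw [show blockProd p vv e = 0 from he, zero_mul]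
    · rw [hlogQT e he]
  have hJe : ∀ e, (∏ i, πX ((seqEquiv X Y Z n e).1 i)) * C.channel PW PWh (seqEquiv X Y Z n e).1
      (seqEquiv X Y Z n e).2.1 (seqEquiv X Y Z n e).2.2 = J e := fun e => (C.sum_joint _ _ _ e).symm
  rw [BGammaN]
  refine (sInf_le (Set.mem_ofPred.2 ⟨C, rfl⟩)).trans ?_
  rw [KL, if_pos]
  · refine ENNReal.ofReal_le_ofReal (le_of_eq_of_le ?_ hsum)
    rw [← Equiv.sum_comp (seqEquiv X Y Z n)]
    refine Finset.sum_congr rfl fun e _ => ?_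
    rw [hJe]
    rfl
  · intro x hx
    obtain ⟨e, rfl⟩ := (seqEquiv X Y Z n).surjective x
    rw [hJe]
    refine hJQ0 e ?_
    by_contra h0
    exact hQT e h0 hx

end Divergence

section Achievability

lemma eventually_sum_floor_pos {ι : Type} [Fintype ι] {q φ : ι → ℝ} (hq : ∀ i, 0 ≤ q i)
    (h : 0 < ∑ i, q i * φ i) :
    ∀ᶠ M : ℕ in Filter.atTop, 0 < ∑ i, (⌊q i * M⌋₊ : ℝ) * φ i := by
  have h1 : Filter.Tendsto (fun M : ℕ => ∑ i, ((⌊q i * M⌋₊ : ℝ) / M) * φ i) Filter.atTop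
      (nhds (∑ i, q i * φ i)) :=
    tendsto_finsetSum _ fun i _ => ((tendsto_nat_floor_mul_div_atTop (hq i)).comp
      tendsto_natCast_atTop_atTop).mul_const _
  filter_upwards [h1.eventually (lt_mem_nhds h), Filter.eventually_gt_atTop 0] with M hM hM0
  have hM' : (0 : ℝ) < M := by exact_mod_cast hM0
  have h2 : ∑ i, ((⌊q i * M⌋₊ : ℝ) / M) * φ i = (∑ i, (⌊q i * M⌋₊ : ℝ) * φ i) / M := by
    rw [Finset.sum_div]; exact Finset.sum_congr rfl fun i _ => by ring
  rw [h2] at hM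
  exact (div_pos_iff_of_pos_right hM').1 hM

lemma HasCounts.append {ι : Type} [Fintype ι] {n m N : ℕ} {v : Fin n → ι} {v' : Fin m → ι}
    {c c' : ι → ℕ} (h : HasCounts v N c) (h' : HasCounts v' N c') :
    HasCounts (Fin.append v v') N (fun i => c i + c' i) := fun F => by
  simp only [Fin.sum_univ_add, Fin.append_left, Fin.append_right, h F, h' F, Nat.cast_add, add_mul,
    Finset.sum_add_distrib, mul_add]

lemma HasCounts.length_eq {ι : Type} [Fintype ι] {n N : ℕ} {v : Fin n → ι} {c : ι → ℕ}
    (h : HasCounts v N c) : n = N * ∑ i, c i := by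
  have h1 := h fun _ => 1
  simp only [Finset.sum_const, Finset.card_univ, Fintype.card_fin, nsmul_eq_mul, mul_one] at h1
  exact_mod_cast h1

variable {ι U Uh W Wh X Y Z B : Type} [Fintype ι] [Fintype U] [Fintype Uh] [Fintype W]
  [Fintype Wh] [Fintype X] [Fintype Y] [Fintype Z] [Fintype B]

namespace LetterFamily

variable (L : LetterFamily ι U Uh X Y Z B) (πX : X → ℝ) (PW : W → ℝ) (PWh : Wh → ℝ)

/-- Key entropy gained minus spent by Charles in a round of type `i`. -/
def gap₁ (i : ι) : ℝ :=
  ent (marg (fun x : ((W × Wh × B) × (U × Uh)) × (X × Y × Z) =>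
    ((x.1.1.1, x.1.1.2.2, x.1.2.1), x.2)) (L.law πX PW PWh i)) - ent (L.obs πX PW PWh i) -
      ent (marg Prod.fst (L.key i))

/-- Key entropy gained minus spent by Bob in a round of type `i`. -/
def gap₂ (i : ι) : ℝ :=
  ent (L.law πX PW PWh i) - ent (L.obs πX PW PWh i) - ent (L.key i)

/-- Divergence of the observation in a round of type `i` from the target. -/
def dist (π : X × Y × Z → ℝ) (i : ι) : ℝ :=
  ∑ e, L.obs πX PW PWh i e * Real.log (L.obs πX PW PWh i e / π e)

end LetterFamily

variable {L : LetterFamily ι U Uh X Y Z B} {πX : X → ℝ} {PW : W → ℝ} {PWh : Wh → ℝ}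

lemma exists_reach (hX : IsDist πX) (hW : IsDist PW) (hWh : IsDist PWh) {i₀ : ι} {s₀ : U × Uh}
    (hkey : ∀ s, L.key i₀ s = ind s₀ s) {c : ι → ℕ} {c₀ : ℕ}
    (h₁ : 0 < ∑ i, c i * L.gap₁ πX PW PWh i) (h₂ : 0 < ∑ i, c i * L.gap₂ πX PW PWh i)
    (h₁' : ∑ i, c i * ent (marg Prod.fst (L.key i)) <
      c₀ * (L.gap₁ πX PW PWh i₀ + ent (marg Prod.fst (L.key i₀))))
    (h₂' : ∑ i, c i * ent (L.key i) < c₀ * (L.gap₂ πX PW PWh i₀ + ent (L.key i₀)))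
    (K : ℕ) {ε : ℝ} (hε : 0 < ε) :
    ∃ N₀ : ℕ, ∀ N, N₀ ≤ N → ∃ (n m : ℕ) (vv : Fin n → ι) (v : Fin m → ι),
      Reach L πX PW PWh vv v ε ∧ HasCounts vv N
        (fun i => (if i = i₀ then c₀ else 0) + K * c i) := by
  have hK : (0 : ℝ) < K + 1 := by positivity
  set δ : ℝ := ε / (K + 1) with hδ
  have hδ0 : 0 < δ := by positivity
  have hlaw := fun i => L.isDist_law hX hW hWh i
  obtain ⟨N₁, hN₁⟩ := exists_blockMaps (c' := fun i => if i = i₀ then c₀ else 0) (c := c) hlaw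
    (fun ω : (W × Wh × B) × (U × Uh) => (ω.1.1, ω.1.2.2, ω.2.1)) L.key_dist
    (by simpa [LetterFamily.gap₁, LetterFamily.obs] using h₁')
    (by simpa [LetterFamily.gap₂, LetterFamily.obs] using h₂') hδ0
  obtain ⟨N₂, hN₂⟩ := exists_blockMaps (c' := c) (c := c) hlaw
    (fun ω : (W × Wh × B) × (U × Uh) => (ω.1.1, ω.1.2.2, ω.2.1)) L.key_dist
    (by
      simp only [LetterFamily.gap₁, mul_sub, Finset.sum_sub_distrib, LetterFamily.obs] at h₁ ⊢
      linarith)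
    (by
      simp only [LetterFamily.gap₂, mul_sub, Finset.sum_sub_distrib, LetterFamily.obs] at h₂ ⊢
      linarith) hδ0
  refine ⟨max N₁ N₂, fun N hN => ?_⟩
  obtain ⟨m, v, hv⟩ := exists_hasCounts N c
  have main : ∀ k : ℕ, ∃ (n : ℕ) (vv : Fin n → ι), Reach L πX PW PWh vv v ((k + 1) * δ) ∧
      HasCounts vv N (fun i => (if i = i₀ then c₀ else 0) + k * c i) := by
    intro k
    induction k with
    | zero =>
      have hc : HasCounts (fun _ : Fin (N * c₀) => i₀) N (fun i => if i = i₀ then c₀ else 0) :=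
        fun F => by simp [mul_assoc]
      obtain ⟨f, g, hs, hT⟩ := hN₁ N ((le_max_left _ _).trans hN) _ _ _ v hc hv
      have hR := (reach_zero (πX := πX) (PW := PW) (PWh := PWh) hkey (N * c₀)).append hX hW hWh
        hs hT
      refine ⟨_, _, by simpa using hR, ?_⟩
      have h0 : HasCounts (Fin.elim0 : Fin 0 → ι) N (fun _ => 0) := fun F => by simp
      simpa using h0.append hc
    | succ k ih =>
      obtain ⟨n, vv, hR, hc⟩ := ih
      obtain ⟨f, g, hs, hT⟩ := hN₂ N ((le_max_right _ _).trans hN) _ _ v v hv hv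
      refine ⟨n + m, Fin.append vv v, ?_, ?_⟩
      · have := hR.append hX hW hWh hs hT
        rw [show (((k + 1 : ℕ) : ℝ) + 1) * δ = (k + 1) * δ + δ by push_cast; ring]
        exact this
      · have := hc.append hv
        have e : (fun i => (if i = i₀ then c₀ else 0) + (k + 1) * c i) =
            fun i => (if i = i₀ then c₀ else 0) + k * c i + c i := by funext i; ring
        rw [e]; exact this
  obtain ⟨n, vv, hR, hc⟩ := main K
  refine ⟨n, m, vv, v, ?_, hc⟩
  rwa [hδ, mul_div_cancel₀ _ hK.ne'] at hR

lemma limit_le_of_family {π : X × Y × Z → ℝ}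
    (hX : IsDist (marg (fun q : X × Y × Z => q.1) π)) (hW : IsDist PW) (hWh : IsDist PWh)
    (hac : ∀ i e, π e = 0 → L.obs (marg (fun q : X × Y × Z => q.1) π) PW PWh i e = 0)
    {i₀ : ι} {s₀ : U × Uh} (hkey : ∀ s, L.key i₀ s = ind s₀ s)
    {q : ι → ℝ} (hq : ∀ i, 0 ≤ q i) {t : ℝ}
    (h₁ : 0 < ∑ i, q i * L.gap₁ (marg (fun q : X × Y × Z => q.1) π) PW PWh i)
    (h₂ : 0 < ∑ i, q i * L.gap₂ (marg (fun q : X × Y × Z => q.1) π) PW PWh i)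
    (h₃ : 0 < ∑ i, q i * (t - L.dist (marg (fun q : X × Y × Z => q.1) π) PW PWh π i))
    (h₁' : 0 < L.gap₁ (marg (fun q : X × Y × Z => q.1) π) PW PWh i₀ +
      ent (marg Prod.fst (L.key i₀)))
    (h₂' : 0 < L.gap₂ (marg (fun q : X × Y × Z => q.1) π) PW PWh i₀ + ent (L.key i₀))
    {G : ℝ≥0∞}
    (hG : Filter.Tendsto (fun n : ℕ => BGammaN W Wh X Y Z B PW PWh π n / (n : ℝ≥0∞))
      Filter.atTop (nhds G)) :
    G ≤ ENNReal.ofReal t := by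
  set πX := marg (fun q : X × Y × Z => q.1) π with hπX
  obtain ⟨M, hM₁, hM₂, hM₃⟩ := ((eventually_sum_floor_pos hq h₁).and
    ((eventually_sum_floor_pos hq h₂).and (eventually_sum_floor_pos hq h₃))).exists
  set c : ι → ℕ := fun i => ⌊q i * M⌋₊ with hc
  obtain ⟨a₁, ha₁⟩ := exists_nat_gt ((∑ i, c i * ent (marg Prod.fst (L.key i))) /
    (L.gap₁ πX PW PWh i₀ + ent (marg Prod.fst (L.key i₀))))
  obtain ⟨a₂, ha₂⟩ := exists_nat_gt ((∑ i, c i * ent (L.key i)) /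
    (L.gap₂ πX PW PWh i₀ + ent (L.key i₀)))
  rw [div_lt_iff₀ h₁'] at ha₁
  rw [div_lt_iff₀ h₂'] at ha₂
  set c₀ : ℕ := max a₁ a₂ + 1 with hc₀
  have hc₁ : ∑ i, c i * ent (marg Prod.fst (L.key i)) <
      c₀ * (L.gap₁ πX PW PWh i₀ + ent (marg Prod.fst (L.key i₀))) :=
    ha₁.trans_le (mul_le_mul_of_nonneg_right (by
      rw [hc₀]; exact_mod_cast (le_max_left a₁ a₂).trans (Nat.le_succ _)) h₁'.le)
  have hc₂ : ∑ i, c i * ent (L.key i) < c₀ * (L.gap₂ πX PW PWh i₀ + ent (L.key i₀)) :=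
    ha₂.trans_le (mul_le_mul_of_nonneg_right (by
      rw [hc₀]; exact_mod_cast (le_max_right a₁ a₂).trans (Nat.le_succ _)) h₂'.le)
  obtain ⟨K, hK⟩ := exists_nat_gt ((c₀ * (L.dist πX PW PWh π i₀ - t)) /
    ∑ i, c i * (t - L.dist πX PW PWh π i))
  rw [div_lt_iff₀ hM₃] at hK
  set cc : ι → ℕ := fun i => (if i = i₀ then c₀ else 0) + K * c i with hcc
  set σ : ℝ := ∑ i, cc i * (t - L.dist πX PW PWh π i) with hσ
  have hσ0 : 0 < σ := by
    have : σ = c₀ * (t - L.dist πX PW PWh π i₀) + K * ∑ i, c i * (t - L.dist πX PW PWh π i) := by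
      simp only [hσ, hcc, Nat.cast_add, Nat.cast_mul, add_mul, Finset.sum_add_distrib,
        Finset.mul_sum, mul_assoc]
      simp
    rw [this]; linarith
  set A : ℕ := ∑ i, cc i with hA
  have hA0 : 0 < A := by
    refine Finset.sum_pos' (fun _ _ => Nat.zero_le _) ⟨i₀, Finset.mem_univ _, ?_⟩
    simp [hcc, hc₀]
  obtain ⟨b, hb0, hb₁, hb₂⟩ : ∃ b : ℝ, 0 ≤ b ∧ (∀ i e, |Real.log (L.obs πX PW PWh i e)| ≤ b) ∧
      ∀ i e, |Real.log (L.obs πX PW PWh i e / π e)| ≤ b := by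
    obtain ⟨b₁, h1⟩ := (Set.finite_range fun x : ι × (X × Y × Z) =>
      |Real.log (L.obs πX PW PWh x.1 x.2)|).bddAbove
    obtain ⟨b₂, h2⟩ := (Set.finite_range fun x : ι × (X × Y × Z) =>
      |Real.log (L.obs πX PW PWh x.1 x.2 / π x.2)|).bddAbove
    exact ⟨max 0 (max b₁ b₂), le_max_left _ _,
      fun i e => (h1 ⟨(i, e), rfl⟩).trans ((le_max_left _ _).trans (le_max_right _ _)),
      fun i e => (h2 ⟨(i, e), rfl⟩).trans ((le_max_right _ _).trans (le_max_right _ _))⟩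
  set ε : ℝ := min 1 (σ / (2 + 2 * (A * b))) with hε
  have hd0 : 0 < 2 + 2 * (A * b) := by positivity
  have hε0 : 0 < ε := lt_min one_pos (div_pos hσ0 hd0)
  have hεσ : ε * (2 + 2 * (A * b)) ≤ σ := by
    rw [← le_div_iff₀ hd0]; exact min_le_right _ _
  obtain ⟨N₀, hN₀⟩ := exists_reach hX hW hWh hkey hM₁ hM₂ hc₁ hc₂ K hε0
  have hsub : Filter.Tendsto (fun N : ℕ => N * A) Filter.atTop Filter.atTop :=
    Filter.tendsto_id.atTop_mul_const' hA0
  refine le_of_tendsto (hG.comp hsub) ?_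
  filter_upwards [Filter.eventually_ge_atTop N₀, Filter.eventually_ge_atTop 1] with N hN hN1
  obtain ⟨n, m, vv, v, hR, hcnt⟩ := hN₀ N hN
  obtain rfl : n = N * A := hcnt.length_eq
  refine ENNReal.div_le_of_le_mul ?_
  refine (hR.bGammaN_le hX hW hWh (min_le_left _ _) hb0 hac hb₁ hb₂).trans ?_
  have hN' : (1 : ℝ) ≤ N := by exact_mod_cast hN1
  rw [← ENNReal.ofReal_natCast, ← ENNReal.ofReal_mul' (Nat.cast_nonneg _)]
  refine ENNReal.ofReal_le_ofReal ?_
  change ∑ t, L.dist πX PW PWh π (vv t) + _ ≤ _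
  rw [hcnt]
  have e1 : σ = t * A - ∑ i, cc i * L.dist πX PW PWh π i := by
    simp only [hσ, mul_sub, Finset.sum_sub_distrib, ← Finset.sum_mul, hA, Nat.cast_sum]; ring
  rw [Nat.cast_mul]
  have h5 : ε * (2 + 2 * (N * A * b)) ≤ N * σ := by
    calc ε * (2 + 2 * (N * A * b)) ≤ N * (ε * (2 + 2 * (A * b))) := by
          nlinarith [mul_nonneg hε0.le (sub_nonneg.2 hN')]
      _ ≤ N * σ := mul_le_mul_of_nonneg_left hεσ (by positivity)
  have e2 : ∑ i, (cc i : ℝ) * L.dist πX PW PWh π i = t * A - σ := by linarith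
  change N * ∑ i, (cc i : ℝ) * L.dist πX PW PWh π i + _ ≤ _
  rw [e2]
  nlinarith

end Achievability

section Entropy

variable {α β γ δ : Type} [Fintype α] [Fintype β] [Fintype γ] [Fintype δ]

omit [Fintype γ] in
lemma marg_comp (f : α → β) (g : β → γ) (p : α → ℝ) :
    marg g (marg f p) = marg (fun a => g (f a)) p := by
  funext c
  have := sum_marg_mul f p (fun b => if g b = c then 1 else 0)
  simpa [marg] using this

lemma marg_id (p : α → ℝ) : marg (fun a => a) p = p := by
  funext a; simp [marg]

lemma isDist_marg (f : α → β) {p : α → ℝ} (hp : IsDist p) : IsDist (marg f p) :=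
  ⟨marg_nonneg _ hp.1, by rw [sum_marg, hp.2]⟩

lemma ent_marg_injective (f : α → β) {σ : β → γ} (hσ : Function.Injective σ) (p : α → ℝ) :
    ent (marg (fun a => σ (f a)) p) = ent (marg f p) := by
  rw [ent_marg_eq, ent_marg_eq]
  simp only [marg, hσ.eq_iff]

lemma ent_mul {p : α → ℝ} {q : β → ℝ} (hp : IsDist p) (hq : IsDist q) :
    ent (fun x : α × β => p x.1 * q x.2) = ent p + ent q := by
  simp only [ent, Fintype.sum_prod_type, Real.negMulLog_mul, Finset.sum_add_distrib,
    ← Finset.mul_sum, ← Finset.sum_mul, hp.2, hq.2, one_mul]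

omit [Fintype γ] [Fintype δ] in
lemma marg_mul (f : α → γ) (g : β → δ) (p : α → ℝ) (q : β → ℝ) :
    marg (fun x : α × β => (f x.1, g x.2)) (fun x => p x.1 * q x.2) =
      fun y => marg f p y.1 * marg g q y.2 := by
  funext ⟨c, d⟩
  simp only [marg, Fintype.sum_prod_type, Prod.mk.injEq, Finset.sum_mul_sum]
  refine Finset.sum_congr rfl fun a _ => Finset.sum_congr rfl fun b _ => ?_
  by_cases h1 : f a = c <;> by_cases h2 : g b = d <;> simp [h1, h2]

lemma ent_nonneg {p : α → ℝ} (hp : IsDist p) : 0 ≤ ent p :=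
  Finset.sum_nonneg fun a _ => Real.negMulLog_nonneg (hp.1 a)
    ((Finset.single_le_sum (fun a _ => hp.1 a) (Finset.mem_univ a)).trans_eq hp.2)

lemma sum_marg_pair (f : α → β) (h : α → δ) (p : α → ℝ) (d : δ) :
    ∑ b, marg (fun a => (f a, h a)) p (b, d) = marg h p d := by
  have := congrFun (marg_comp (fun a => (f a, h a)) Prod.snd p) d
  rw [marg_snd] at this
  exact this

lemma condMI_nonneg (f : α → β) (g : α → γ) (h : α → δ) {p : α → ℝ} (hp : IsDist p) :
    0 ≤ condMI f g h p := by
  set F := marg (fun a => (f a, h a)) p with hF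
  set G := marg (fun a => (g a, h a)) p with hG
  set H := marg h p with hH
  set J := marg (fun a => ((f a, g a), h a)) p with hJ
  have hF0 : ∀ x, 0 ≤ F x := marg_nonneg _ hp.1
  have hG0 : ∀ x, 0 ≤ G x := marg_nonneg _ hp.1
  have hH0 : ∀ x, 0 ≤ H x := marg_nonneg _ hp.1
  have hJ0 : ∀ x, 0 ≤ J x := marg_nonneg _ hp.1
  have e1 : condMI f g h p = -∑ a, p a * (Real.log (F (f a, h a)) + Real.log (G (g a, h a)) -
      Real.log (J ((f a, g a), h a)) - Real.log (H (h a))) := by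
    have E1 := ent_marg_eq (fun a => (f a, h a)) p
    have E2 := ent_marg_eq (fun a => (g a, h a)) p
    have E3 := ent_marg_eq (fun a => ((f a, g a), h a)) p
    have E4 := ent_marg_eq h p
    rw [condMI, condEnt, condEnt, condEnt, E1, E2, E3, E4]
    simp only [mul_add, mul_sub, Finset.sum_add_distrib, Finset.sum_sub_distrib, ← hF, ← hG, ← hH,
      ← hJ]
    ring
  have hpt : ∀ a, p a * (Real.log (F (f a, h a)) + Real.log (G (g a, h a)) -
      Real.log (J ((f a, g a), h a)) - Real.log (H (h a))) ≤
      p a * (F (f a, h a) * G (g a, h a) / (J ((f a, g a), h a) * H (h a))) - p a := by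
    intro a
    rcases (hp.1 a).eq_or_lt with h0 | hpos
    · simp [← h0]
    have p1 : 0 < F (f a, h a) := hpos.trans_le (le_marg (fun a => (f a, h a)) hp.1 a)
    have p2 : 0 < G (g a, h a) := hpos.trans_le (le_marg (fun a => (g a, h a)) hp.1 a)
    have p3 : 0 < J ((f a, g a), h a) := hpos.trans_le (le_marg (fun a => ((f a, g a), h a)) hp.1 a)
    have p4 : 0 < H (h a) := hpos.trans_le (le_marg h hp.1 a)
    have h1 := Real.log_le_sub_one_of_pos (div_pos (mul_pos p1 p2) (mul_pos p3 p4))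
    rw [Real.log_div (mul_pos p1 p2).ne' (mul_pos p3 p4).ne', Real.log_mul p1.ne' p2.ne',
      Real.log_mul p3.ne' p4.ne'] at h1
    nlinarith
  have hsum : ∑ a, p a * (F (f a, h a) * G (g a, h a) / (J ((f a, g a), h a) * H (h a))) ≤ 1 := by
    rw [← sum_marg_mul (fun a => ((f a, g a), h a)) p fun x =>
      F (x.1.1, x.2) * G (x.1.2, x.2) / (J x * H x.2), ← hJ]
    calc ∑ x : (β × γ) × δ, J x * (F (x.1.1, x.2) * G (x.1.2, x.2) / (J x * H x.2))
        ≤ ∑ x : (β × γ) × δ, F (x.1.1, x.2) * G (x.1.2, x.2) / H x.2 := by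
          refine Finset.sum_le_sum fun x _ => ?_
          rcases (hJ0 x).eq_or_lt with h0 | hpos
          · rw [← h0, zero_mul]; exact div_nonneg (mul_nonneg (hF0 _) (hG0 _)) (hH0 _)
          · exact le_of_eq (by field_simp)
      _ = ∑ d, (∑ b, F (b, d)) * (∑ c, G (c, d)) / H d := by
          rw [Fintype.sum_prod_type, Finset.sum_comm]
          refine Finset.sum_congr rfl fun d _ => ?_
          rw [Finset.sum_mul_sum, Finset.sum_div, Fintype.sum_prod_type]
          exact Finset.sum_congr rfl fun b _ => by rw [Finset.sum_div]
      _ = ∑ d, H d := by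
          refine Finset.sum_congr rfl fun d _ => ?_
          rw [hF, hG, sum_marg_pair, sum_marg_pair, ← hH]
          by_cases h0 : H d = 0
          · simp [h0]
          · field_simp
      _ = 1 := by rw [hH, sum_marg, hp.2]
  have := (Finset.sum_le_sum fun a (_ : a ∈ Finset.univ) => hpt a)
  rw [Finset.sum_sub_distrib, hp.2] at this
  rw [e1]
  linarith

/-- The conditional law of `p` given `h = d`. -/
def condLaw (h : α → δ) (p : α → ℝ) (d : δ) (a : α) : ℝ :=
  if h a = d then p a / marg h p d else 0

omit [Fintype δ] in
lemma isDist_condLaw (h : α → δ) {p : α → ℝ} (hp : IsDist p) {d : δ} (hd : 0 < marg h p d) :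
    IsDist (condLaw h p d) := by
  refine ⟨fun a => ?_, ?_⟩
  · unfold condLaw
    split_ifs
    · exact div_nonneg (hp.1 a) hd.le
    · exact le_rfl
  · have : ∀ a, condLaw h p d a = (if h a = d then p a else 0) / marg h p d := fun a => by
      unfold condLaw; split_ifs <;> simp
    simp only [this, ← Finset.sum_div]
    exact div_self hd.ne'

omit [Fintype γ] [Fintype δ] in
lemma marg_pair_eq (k : α → γ) (h : α → δ) {p : α → ℝ} {c : γ} {d : δ} (hd : 0 < marg h p d) :
    marg (fun a => (k a, h a)) p (c, d) = marg h p d * marg k (condLaw h p d) c := by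
  have e : marg h p d * marg k (condLaw h p d) c =
      ∑ a, marg h p d * if k a = c then condLaw h p d a else 0 := Finset.mul_sum _ _ _
  rw [e]
  refine Finset.sum_congr rfl fun a _ => ?_
  simp only [condLaw, Prod.mk.injEq]
  by_cases h1 : k a = c <;> by_cases h2 : h a = d <;> simp [h1, h2, mul_div_cancel₀ _ hd.ne']

lemma ent_marg_pair (k : α → γ) (h : α → δ) {p : α → ℝ} (hp : IsDist p) :
    ent (marg (fun a => (k a, h a)) p) =
      ent (marg h p) + ∑ d, marg h p d * ent (marg k (condLaw h p d)) := by
  have hpt : ∀ a, p a * Real.log (marg (fun a => (k a, h a)) p (k a, h a)) =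
      p a * Real.log (marg h p (h a)) +
        ∑ d, (if h a = d then p a else 0) * Real.log (marg k (condLaw h p d) (k a)) := by
    intro a
    rw [Finset.sum_eq_single (h a) (fun d _ hd => by simp [Ne.symm hd]) (by simp), if_pos rfl,
      ← mul_add]
    rcases (hp.1 a).eq_or_lt with h0 | hpos
    · simp [← h0]
    have hd := hpos.trans_le (le_marg h hp.1 a)
    rw [marg_pair_eq k h hd, Real.log_mul hd.ne']
    have h1 := le_marg k (isDist_condLaw h hp hd).1 a
    have h2 : 0 < condLaw h p (h a) a := by
      rw [condLaw, if_pos rfl]; exact div_pos hpos hd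
    exact (h2.trans_le h1).ne'
  rw [ent_marg_eq, ent_marg_eq]
  simp only [hpt, Finset.sum_add_distrib]
  rw [Finset.sum_comm, neg_add, ← Finset.sum_neg_distrib (s := (Finset.univ : Finset δ))]
  congr 1
  refine Finset.sum_congr rfl fun d _ => ?_
  rw [ent_marg_eq, mul_neg, Finset.mul_sum]
  congr 1
  refine Finset.sum_congr rfl fun a _ => ?_
  rw [← mul_assoc]
  congr 1
  unfold condLaw
  split_ifs with h1
  · rcases (marg_nonneg h hp.1 d).eq_or_lt with h0 | hd
    · have := le_marg h hp.1 a
      rw [h1, ← h0] at this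
      rw [← h0, zero_mul]; exact le_antisymm this (hp.1 a)
    · rw [mul_div_cancel₀ _ hd.ne']
  · rw [mul_zero]

end Entropy

section Core

variable {ι U Uh W Wh X Y Z B : Type} [Fintype U] [Fintype Uh] [Fintype W] [Fintype Wh]
  [Fintype X] [Fintype Y] [Fintype Z] [Fintype B]

namespace LetterFamily

/-- Joint law of the message, the keys and the observation in a round of type `i`. -/
def core (L : LetterFamily ι U Uh X Y Z B) (πX : X → ℝ) (i : ι)
    (c : (B × (U × Uh)) × (X × Y × Z)) : ℝ :=
  πX c.2.1 * L.key i c.1.2 * L.enc i c.2.1 c.1.2 c.1.1 * L.decY i c.1.1 c.1.2 c.2.2.1 *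
    L.decZ i c.1.1 c.1.2.1 c.2.2.2

variable {L : LetterFamily ι U Uh X Y Z B} {πX : X → ℝ} {PW : W → ℝ} {PWh : Wh → ℝ}

lemma law_eq_marg (i : ι) :
    L.law πX PW PWh i = marg
      (fun y : (W × Wh) × ((B × (U × Uh)) × (X × Y × Z)) =>
        (((y.1.1, y.1.2, y.2.1.1), y.2.1.2), y.2.2))
      (fun y => PW y.1.1 * PWh y.1.2 * L.core πX i y.2) := by
  funext ⟨⟨⟨w, wh, b⟩, s⟩, e⟩
  have h : ∀ y : (W × Wh) × ((B × (U × Uh)) × (X × Y × Z)),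
      (((y.1.1, y.1.2, y.2.1.1), y.2.1.2), y.2.2) = (((w, wh, b), s), e) ↔
        y = ((w, wh), ((b, s), e)) := by
    rintro ⟨⟨w, wh⟩, ⟨⟨b, s⟩, e⟩⟩
    simp only [Prod.mk.injEq]
    tauto
  simp only [marg, h, Finset.sum_ite_eq', Finset.mem_univ, if_true, law, round, core]
  ring

lemma isDist_key_source (hW : IsDist PW) (hWh : IsDist PWh) :
    IsDist (fun y : W × Wh => PW y.1 * PWh y.2) :=
  ⟨fun y => mul_nonneg (hW.1 _) (hWh.1 _), by
    simp only [Fintype.sum_prod_type, ← Finset.mul_sum, hW.2, hWh.2, mul_one]⟩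

lemma core_eq_marg (hW : IsDist PW) (hWh : IsDist PWh) (i : ι) :
    L.core πX i = marg (fun x : ((W × Wh × B) × (U × Uh)) × (X × Y × Z) =>
      ((x.1.1.2.2, x.1.2), x.2)) (L.law πX PW PWh i) := by
  rw [law_eq_marg, marg_comp]
  funext c
  have := marg_snd (fun y : (W × Wh) × ((B × (U × Uh)) × (X × Y × Z)) =>
    PW y.1.1 * PWh y.1.2 * L.core πX i y.2) c
  dsimp only at this
  rw [← Finset.sum_mul, (isDist_key_source hW hWh).2, one_mul] at this
  exact this.symm

lemma obs_eq_marg_core (hW : IsDist PW) (hWh : IsDist PWh) (i : ι) :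
    L.obs πX PW PWh i = marg Prod.snd (L.core πX i) := by
  rw [core_eq_marg hW hWh, marg_comp, obs]

variable (hX : IsDist πX) (hW : IsDist PW) (hWh : IsDist PWh)

include hX hW hWh in
lemma isDist_core (i : ι) : IsDist (L.core πX i) := by
  rw [core_eq_marg hW hWh]
  exact isDist_marg _ (L.isDist_law hX hW hWh i)

include hX hW hWh in
lemma gap₁_eq (i : ι) :
    L.gap₁ πX PW PWh i = ent PW + ent (marg (fun c : (B × (U × Uh)) × (X × Y × Z) =>
      ((c.1.1, c.1.2.1), c.2)) (L.core πX i)) - ent (marg Prod.snd (L.core πX i)) -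
        ent (marg Prod.fst (L.key i)) := by
  rw [gap₁, obs_eq_marg_core hW hWh, law_eq_marg, marg_comp]
  have h1 := ent_marg_injective
    (fun y : (W × Wh) × ((B × (U × Uh)) × (X × Y × Z)) => (y.1.1, ((y.2.1.1, y.2.1.2.1), y.2.2)))
    (σ := fun z : W × ((B × U) × (X × Y × Z)) => ((z.1, z.2.1.1, z.2.1.2), z.2.2))
    (by
      rintro ⟨w, ⟨b, u⟩, e⟩ ⟨w', ⟨b', u'⟩, e'⟩
      simp only [Prod.mk.injEq]
      tauto)
    (fun y => PW y.1.1 * PWh y.1.2 * L.core πX i y.2)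
  rw [h1]
  have h2 := marg_mul (Prod.fst : W × Wh → W)
    (fun c : (B × (U × Uh)) × (X × Y × Z) => ((c.1.1, c.1.2.1), c.2))
    (fun y => PW y.1 * PWh y.2) (L.core πX i)
  have h3 : marg (Prod.fst : W × Wh → W) (fun y => PW y.1 * PWh y.2) = PW := by
    funext w
    rw [marg_fst]
    simp only [← Finset.mul_sum, hWh.2, mul_one]
  rw [h2, h3, ent_mul hW (isDist_marg _ (isDist_core hX hW hWh i))]

include hX hW hWh in
lemma gap₂_eq (i : ι) :
    L.gap₂ πX PW PWh i = ent PW + ent PWh + ent (L.core πX i) -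
      ent (marg Prod.snd (L.core πX i)) - ent (L.key i) := by
  rw [gap₂, obs_eq_marg_core hW hWh, law_eq_marg]
  have h1 := ent_marg_injective
    (fun y : (W × Wh) × ((B × (U × Uh)) × (X × Y × Z)) => y)
    (σ := fun y : (W × Wh) × ((B × (U × Uh)) × (X × Y × Z)) =>
        (((y.1.1, y.1.2, y.2.1.1), y.2.1.2), y.2.2))
    (by
      rintro ⟨⟨w, wh⟩, ⟨b, u⟩, e⟩ ⟨⟨w', wh'⟩, ⟨b', u'⟩, e'⟩
      simp only [Prod.mk.injEq]
      tauto)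
    (fun y => PW y.1.1 * PWh y.1.2 * L.core πX i y.2)
  rw [h1, marg_id, ent_mul (isDist_key_source hW hWh) (isDist_core hX hW hWh i), ent_mul hW hWh]

include hX hW hWh in
lemma marg_core_key (i : ι) :
    marg (fun c : (B × (U × Uh)) × (X × Y × Z) => c.1.2) (L.core πX i) = L.key i := by
  rw [core_eq_marg hW hWh, marg_comp]
  funext s
  rw [marg, Fintype.sum_prod_type, Fintype.sum_prod_type, Finset.sum_comm]
  rw [Finset.sum_eq_single s (fun s' _ h => by simp [h]) (by simp)]
  simp only [if_true, law, ← Finset.mul_sum, L.sum_round hX hW hWh, mul_one]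

end LetterFamily

end Core

section CondEnt

variable {α β γ δ : Type} [Fintype α] [Fintype β] [Fintype γ] [Fintype δ]

lemma condEnt_eq_sum (k : α → γ) (h : α → δ) {p : α → ℝ} (hp : IsDist p) :
    condEnt k h p = ∑ d, marg h p d * ent (marg k (condLaw h p d)) := by
  rw [condEnt, ent_marg_pair k h hp, add_sub_cancel_left]

end CondEnt

section TestFamily

variable {U Uh V W Wh X Y Z B : Type} [Fintype U] [Fintype Uh] [Fintype V] [Fintype W]
  [Fintype Wh] [Fintype X] [Fintype Y] [Fintype Z] [Fintype B]

lemma isDist_ind {α : Type} [Fintype α] (a : α) : IsDist (ind a) :=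
  ⟨fun b => ind_nonneg a b, by simp [ind]⟩

lemma isDist_uniform {α : Type} [Fintype α] (h : 2 ≤ Fintype.card α) :
    IsDist (fun _ : α => (Fintype.card α : ℝ)⁻¹) :=
  ⟨fun _ => by positivity, by
    have : (Fintype.card α : ℝ) ≠ 0 := by positivity
    simp [this]⟩

lemma ent_uniform_pos {α : Type} [Fintype α] (h : 2 ≤ Fintype.card α) :
    0 < ent (fun _ : α => (Fintype.card α : ℝ)⁻¹) := by
  have h0 : (Fintype.card α : ℝ) ≠ 0 := by positivity
  have h1 : (1 : ℝ) < Fintype.card α := by exact_mod_cast h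
  have : ent (fun _ : α => (Fintype.card α : ℝ)⁻¹) = Real.log (Fintype.card α) := by
    simp only [ent, Finset.sum_const, Finset.card_univ, nsmul_eq_mul, Real.negMulLog,
      Real.log_inv]
    field_simp
  rw [this]
  exact Real.log_pos h1

variable {πX : X → ℝ} {P : U × Uh × V → ℝ} {PB : X × U × Uh × V → B → ℝ}
  {PY : B × U × Uh × V → Y → ℝ} {PZ : B × U × V → Z → ℝ}

lemma sum_mul_bJoint (hX : IsDist πX) (hB : IsKernel PB) (hY : IsKernel PY) (hZ : IsKernel PZ)
    (φ : U × Uh × V → ℝ) :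
    ∑ q, φ (q.2.1, q.2.2.1, q.2.2.2.1) * bJoint πX P PB PY PZ q = ∑ s, φ s * P s := by
  simp only [bJoint, Fintype.sum_prod_type, ← Finset.mul_sum, (hZ _).2, (hY _).2, (hB _).2,
    mul_one]
  rw [Finset.sum_comm]
  refine Finset.sum_congr rfl fun u _ => ?_
  rw [Finset.sum_comm]
  refine Finset.sum_congr rfl fun uh _ => ?_
  rw [Finset.sum_comm]
  refine Finset.sum_congr rfl fun v _ => ?_
  rw [← Finset.mul_sum, ← Finset.sum_mul, hX.2, one_mul]

lemma isDist_bJoint (hX : IsDist πX) (hP : IsDist P) (hB : IsKernel PB) (hY : IsKernel PY)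
    (hZ : IsKernel PZ) : IsDist (bJoint πX P PB PY PZ) := by
  refine ⟨fun q => mul_nonneg (mul_nonneg (mul_nonneg (mul_nonneg (hX.1 _) (hP.1 _))
    ((hB _).1 _)) ((hY _).1 _)) ((hZ _).1 _), ?_⟩
  have := sum_mul_bJoint (P := P) hX hB hY hZ fun _ => 1
  simpa only [one_mul, hP.2] using this

lemma marg_bJoint (hX : IsDist πX) (hB : IsKernel PB) (hY : IsKernel PY) (hZ : IsKernel PZ) :
    marg (fun q : X × U × Uh × V × B × Y × Z => q.2.2.2.1) (bJoint πX P PB PY PZ) =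
      marg (fun p : U × Uh × V => p.2.2) P := by
  funext v
  have := sum_mul_bJoint (P := P) hX hB hY hZ fun s => if s.2.2 = v then 1 else 0
  simpa only [ite_mul, one_mul, zero_mul, marg] using this

/-- The letters of the achievability scheme: one for each value of the time-sharing variable, and
one which produces uniform messages. -/
def testFamily (hP : IsDist P) (hB : IsKernel PB) (hY : IsKernel PY) (hZ : IsKernel PZ)
    (hcard : 2 ≤ Fintype.card B) (s₀ : U × Uh) (y : Y) (z : Z) :
    LetterFamily (Option {v : V // 0 < marg (fun p : U × Uh × V => p.2.2) P v}) U Uh X Y Z B where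
  key i s := i.elim (ind s₀ s) fun v =>
    P (s.1, s.2, v) / marg (fun p : U × Uh × V => p.2.2) P v
  enc i x s b := i.elim (Fintype.card B : ℝ)⁻¹ fun v => PB (x, s.1, s.2, v) b
  decY i b s y' := i.elim (ind y y') fun v => PY (b, s.1, s.2, v) y'
  decZ i b u z' := i.elim (ind z z') fun v => PZ (b, u, v) z'
  key_dist i := by
    cases i with
    | none => exact isDist_ind s₀
    | some v =>
      refine ⟨fun s => div_nonneg (hP.1 _) v.2.le, ?_⟩
      simp only [Option.elim_some, ← Finset.sum_div]
      rw [div_eq_one_iff_eq v.2.ne', marg]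
      simp only [Fintype.sum_prod_type, Finset.sum_ite_eq', Finset.mem_univ, if_true]
  enc_dist i x s := by
    cases i with
    | none => exact isDist_uniform hcard
    | some v => exact hB _
  decY_dist i b s := by
    cases i with
    | none => exact isDist_ind y
    | some v => exact hY _
  decZ_dist i b u := by
    cases i with
    | none => exact isDist_ind z
    | some v => exact hZ _

section

variable (hX : IsDist πX) (hP : IsDist P) (hB : IsKernel PB) (hY : IsKernel PY)
  (hZ : IsKernel PZ) (hcard : 2 ≤ Fintype.card B) (s₀ : U × Uh) (y : Y) (z : Z)

include hX in
lemma core_testFamily_some (v : {v : V // 0 < marg (fun p : U × Uh × V => p.2.2) P v}) :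
    (testFamily hP hB hY hZ hcard s₀ y z).core πX (some v) =
      marg (fun q : X × U × Uh × V × B × Y × Z =>
          ((q.2.2.2.2.1, (q.2.1, q.2.2.1)), (q.1, q.2.2.2.2.2)))
        (condLaw (fun q => q.2.2.2.1) (bJoint πX P PB PY PZ) v.1) := by
  obtain ⟨v, hv⟩ := v
  funext ⟨⟨b, u, uh⟩, x, y', z'⟩
  have h : ∀ q : X × U × Uh × V × B × Y × Z,
      (if ((q.2.2.2.2.1, (q.2.1, q.2.2.1)), (q.1, q.2.2.2.2.2)) = ((b, u, uh), x, y', z') then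
        condLaw (fun q => q.2.2.2.1) (bJoint πX P PB PY PZ) v q else 0) =
      if q = (x, u, uh, v, b, y', z') then
        bJoint πX P PB PY PZ q / marg (fun p : U × Uh × V => p.2.2) P v else 0 := by
    rintro ⟨x1, u1, uh1, v1, b1, y1, z1⟩
    rw [condLaw, marg_bJoint hX hB hY hZ, ← ite_and]
    refine if_congr ?_ rfl rfl
    simp only [Prod.mk.injEq]
    tauto
  rw [marg]
  simp only [h]
  refine Eq.trans ?_ (Finset.sum_eq_single (x, u, uh, v, b, y', z') (fun q _ hq => if_neg hq)
    fun hq => absurd (Finset.mem_univ _) hq).symm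
  rw [if_pos rfl]
  simp only [LetterFamily.core, testFamily, Option.elim_some, bJoint]
  ring

omit [Fintype X] in
lemma core_testFamily_none :
    (testFamily hP hB hY hZ hcard s₀ y z).core πX none = fun c =>
      ((Fintype.card B : ℝ)⁻¹ * ind s₀ c.1.2) * (πX c.2.1 * (ind y c.2.2.1 * ind z c.2.2.2)) := by
  funext c
  simp only [LetterFamily.core, testFamily, Option.elim_none]
  ring

lemma isDist_ind_source (hX : IsDist πX) :
    IsDist (fun e : X × Y × Z => πX e.1 * (ind y e.2.1 * ind z e.2.2)) :=
  LetterFamily.isDist_key_source hX (LetterFamily.isDist_key_source (isDist_ind y) (isDist_ind z))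

end

end TestFamily

section Feasible

variable {U Uh V W Wh X Y Z B : Type} [Fintype U] [Fintype Uh] [Fintype V] [Fintype W]
  [Fintype Wh] [Fintype X] [Fintype Y] [Fintype Z] [Fintype B]
  {πX : X → ℝ} {PW : W → ℝ} {PWh : Wh → ℝ} {P : U × Uh × V → ℝ} {PB : X × U × Uh × V → B → ℝ}
  {PY : B × U × Uh × V → Y → ℝ} {PZ : B × U × V → Z → ℝ}

lemma sum_subtype_pos {p : V → ℝ} (hp : ∀ v, 0 ≤ p v) (F : V → ℝ) :
    ∑ v : {v // 0 < p v}, p v * F v = ∑ v, p v * F v := by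
  rw [← Finset.sum_subtype (Finset.univ.filter fun v => 0 < p v) (by simp) fun v => p v * F v]
  refine Finset.sum_filter_of_ne fun v _ h => lt_of_le_of_ne (hp v) fun h0 => h ?_
  rw [← h0, zero_mul]

lemma marg_injective_apply {α β γ : Type} [Fintype α] (f : α → β) {σ : β → γ}
    (hσ : Function.Injective σ) (p : α → ℝ) (b : β) :
    marg (fun a => σ (f a)) p (σ b) = marg f p b := by
  simp only [marg, hσ.eq_iff]

section

variable (hX : IsDist πX) (hW : IsDist PW) (hWh : IsDist PWh) (hP : IsDist P) (hB : IsKernel PB)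
  (hY : IsKernel PY) (hZ : IsKernel PZ) (hcard : 2 ≤ Fintype.card B) (s₀ : U × Uh) (y : Y) (z : Z)

include hX hP hB hY hZ in
lemma sum_ent_condLaw {γ : Type} [Fintype γ] (k : X × U × Uh × V × B × Y × Z → γ) :
    ∑ v : {v : V // 0 < marg (fun p : U × Uh × V => p.2.2) P v},
      marg (fun p : U × Uh × V => p.2.2) P v *
        ent (marg k (condLaw (fun q => q.2.2.2.1) (bJoint πX P PB PY PZ) v.1)) =
      condEnt k (fun q => q.2.2.2.1) (bJoint πX P PB PY PZ) := by
  rw [condEnt_eq_sum _ _ (isDist_bJoint hX hP hB hY hZ), marg_bJoint hX hB hY hZ]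
  exact sum_subtype_pos (marg_nonneg _ hP.1) fun v =>
    ent (marg k (condLaw (fun q => q.2.2.2.1) (bJoint πX P PB PY PZ) v))

include hP in
lemma sum_subtype_marg :
    ∑ v : {v : V // 0 < marg (fun p : U × Uh × V => p.2.2) P v},
      marg (fun p : U × Uh × V => p.2.2) P v = 1 := by
  have := sum_subtype_pos (marg_nonneg (fun p : U × Uh × V => p.2.2) hP.1) fun _ => 1
  simpa only [mul_one, sum_marg, hP.2] using this

include hX hW hWh in
lemma sum_gap₁_testFamily :
    ∑ v : {v : V // 0 < marg (fun p : U × Uh × V => p.2.2) P v},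
      marg (fun p : U × Uh × V => p.2.2) P v *
        (testFamily hP hB hY hZ hcard s₀ y z).gap₁ πX PW PWh (some v) =
      ent PW + condEnt (fun q => (q.2.2.2.2.1, q.2.1))
        (fun q => (q.1, q.2.2.2.2.2.1, q.2.2.2.2.2.2, q.2.2.2.1)) (bJoint πX P PB PY PZ) -
        condEnt (fun q => q.2.1) (fun q => q.2.2.2.1) (bJoint πX P PB PY PZ) := by
  have e : ∀ v, (testFamily hP hB hY hZ hcard s₀ y z).gap₁ πX PW PWh (some v) =
      ent PW + ent (marg (fun q => ((q.2.2.2.2.1, q.2.1), q.1, q.2.2.2.2.2))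
        (condLaw (fun q => q.2.2.2.1) (bJoint πX P PB PY PZ) v.1)) -
      ent (marg (fun q => (q.1, q.2.2.2.2.2))
        (condLaw (fun q => q.2.2.2.1) (bJoint πX P PB PY PZ) v.1)) -
      ent (marg (fun q => q.2.1)
        (condLaw (fun q => q.2.2.2.1) (bJoint πX P PB PY PZ) v.1)) := fun v => by
    rw [LetterFamily.gap₁_eq hX hW hWh, ← LetterFamily.marg_core_key hX hW hWh,
      core_testFamily_some hX, marg_comp, marg_comp, marg_comp, marg_comp]
  simp only [e, mul_sub, mul_add, Finset.sum_add_distrib, Finset.sum_sub_distrib,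
    sum_ent_condLaw hX hP hB hY hZ, ← Finset.sum_mul, sum_subtype_marg hP, one_mul]
  have i1 := ent_marg_injective
    (fun q : X × U × Uh × V × B × Y × Z =>
      ((q.2.2.2.2.1, q.2.1), (q.1, q.2.2.2.2.2.1, q.2.2.2.2.2.2, q.2.2.2.1)))
    (σ := fun t : (B × U) × (X × Y × Z × V) =>
      ((t.1, (t.2.1, t.2.2.1, t.2.2.2.1)), t.2.2.2.2))
    (by
      rintro ⟨a, x, y, z, v⟩ ⟨a', x', y', z', v'⟩
      simp only [Prod.mk.injEq]
      tauto) (bJoint πX P PB PY PZ)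
  have i2 := ent_marg_injective
    (fun q : X × U × Uh × V × B × Y × Z => (q.1, q.2.2.2.2.2.1, q.2.2.2.2.2.2, q.2.2.2.1))
    (σ := fun t : X × Y × Z × V => ((t.1, t.2.1, t.2.2.1), t.2.2.2))
    (by
      rintro ⟨x, y, z, v⟩ ⟨x', y', z', v'⟩
      simp only [Prod.mk.injEq]
      tauto) (bJoint πX P PB PY PZ)
  simp only [condEnt, Prod.mk.eta] at i1 i2 ⊢
  rw [i1, i2]
  ring

include hX hW hWh in
lemma sum_gap₂_testFamily :
    ∑ v : {v : V // 0 < marg (fun p : U × Uh × V => p.2.2) P v},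
      marg (fun p : U × Uh × V => p.2.2) P v *
        (testFamily hP hB hY hZ hcard s₀ y z).gap₂ πX PW PWh (some v) =
      ent PW + ent PWh + condEnt (fun q => (q.2.2.2.2.1, q.2.1, q.2.2.1))
        (fun q => (q.1, q.2.2.2.2.2.1, q.2.2.2.2.2.2, q.2.2.2.1)) (bJoint πX P PB PY PZ) -
        condEnt (fun q => (q.2.1, q.2.2.1)) (fun q => q.2.2.2.1) (bJoint πX P PB PY PZ) := by
  have e : ∀ v, (testFamily hP hB hY hZ hcard s₀ y z).gap₂ πX PW PWh (some v) =
      ent PW + ent PWh + ent (marg (fun q => ((q.2.2.2.2.1, q.2.1, q.2.2.1), q.1, q.2.2.2.2.2))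
        (condLaw (fun q => q.2.2.2.1) (bJoint πX P PB PY PZ) v.1)) -
      ent (marg (fun q => (q.1, q.2.2.2.2.2))
        (condLaw (fun q => q.2.2.2.1) (bJoint πX P PB PY PZ) v.1)) -
      ent (marg (fun q => (q.2.1, q.2.2.1))
        (condLaw (fun q => q.2.2.2.1) (bJoint πX P PB PY PZ) v.1)) := fun v => by
    rw [LetterFamily.gap₂_eq hX hW hWh, ← LetterFamily.marg_core_key hX hW hWh,
      core_testFamily_some hX, marg_comp, marg_comp]
  simp only [e, mul_sub, mul_add, Finset.sum_add_distrib, Finset.sum_sub_distrib,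
    sum_ent_condLaw hX hP hB hY hZ, ← Finset.sum_mul, sum_subtype_marg hP, one_mul]
  have i1 := ent_marg_injective
    (fun q : X × U × Uh × V × B × Y × Z =>
      ((q.2.2.2.2.1, q.2.1, q.2.2.1), (q.1, q.2.2.2.2.2.1, q.2.2.2.2.2.2, q.2.2.2.1)))
    (σ := fun t : (B × U × Uh) × (X × Y × Z × V) =>
      ((t.1, (t.2.1, t.2.2.1, t.2.2.2.1)), t.2.2.2.2))
    (by
      rintro ⟨a, x, y, z, v⟩ ⟨a', x', y', z', v'⟩
      simp only [Prod.mk.injEq]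
      tauto) (bJoint πX P PB PY PZ)
  have i2 := ent_marg_injective
    (fun q : X × U × Uh × V × B × Y × Z => (q.1, q.2.2.2.2.2.1, q.2.2.2.2.2.2, q.2.2.2.1))
    (σ := fun t : X × Y × Z × V => ((t.1, t.2.1, t.2.2.1), t.2.2.2))
    (by
      rintro ⟨x, y, z, v⟩ ⟨x', y', z', v'⟩
      simp only [Prod.mk.injEq]
      tauto) (bJoint πX P PB PY PZ)
  simp only [condEnt, Prod.mk.eta] at i1 i2 ⊢
  rw [i1, i2]
  ring

include hX hW hWh in
lemma marg_bJoint_obs (v : {v : V // 0 < marg (fun p : U × Uh × V => p.2.2) P v}) (e : X × Y × Z) :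
    marg (fun q : X × U × Uh × V × B × Y × Z => (q.1, q.2.2.2.1, q.2.2.2.2.2.1, q.2.2.2.2.2.2))
        (bJoint πX P PB PY PZ) (e.1, v.1, e.2.1, e.2.2) =
      marg (fun p : U × Uh × V => p.2.2) P v *
        (testFamily hP hB hY hZ hcard s₀ y z).obs πX PW PWh (some v) e := by
  have hv : 0 < marg (fun q => q.2.2.2.1) (bJoint πX P PB PY PZ) v.1 := by
    rw [marg_bJoint hX hB hY hZ]
    exact v.2
  have := marg_pair_eq (fun q : X × U × Uh × V × B × Y × Z => (q.1, q.2.2.2.2.2))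
    (fun q => q.2.2.2.1) (c := e) hv
  rw [congrFun (marg_bJoint hX hB hY hZ) v.1] at this
  rw [LetterFamily.obs_eq_marg_core hW hWh, core_testFamily_some hX, marg_comp, ← this]
  exact marg_injective_apply (fun q : X × U × Uh × V × B × Y × Z => ((q.1, q.2.2.2.2.2), q.2.2.2.1))
    (σ := fun t : (X × Y × Z) × V => (t.1.1, t.2, t.1.2.1, t.1.2.2))
    (by
      rintro ⟨⟨x, y, z⟩, v⟩ ⟨⟨x', y', z'⟩, v'⟩
      simp only [Prod.mk.injEq]
      tauto) (bJoint πX P PB PY PZ) (e, v.1)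

include hX hW hWh in
lemma sum_dist_testFamily (π : X × Y × Z → ℝ) :
    ∑ v : {v : V // 0 < marg (fun p : U × Uh × V => p.2.2) P v},
      marg (fun p : U × Uh × V => p.2.2) P v *
        (testFamily hP hB hY hZ hcard s₀ y z).dist πX PW PWh π (some v) =
      ∑ r, marg (fun q : X × U × Uh × V × B × Y × Z =>
          (q.1, q.2.2.2.1, q.2.2.2.2.2.1, q.2.2.2.2.2.2)) (bJoint πX P PB PY PZ) r *
        Real.log (marg (fun q : X × U × Uh × V × B × Y × Z =>
          (q.1, q.2.2.2.1, q.2.2.2.2.2.1, q.2.2.2.2.2.2)) (bJoint πX P PB PY PZ) r /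
          (marg (fun p : U × Uh × V => p.2.2) P r.2.1 * π (r.1, r.2.2.1, r.2.2.2))) := by
  set M := marg (fun q : X × U × Uh × V × B × Y × Z =>
    (q.1, q.2.2.2.1, q.2.2.2.2.2.1, q.2.2.2.2.2.2)) (bJoint πX P PB PY PZ) with hM
  set PV := marg (fun p : U × Uh × V => p.2.2) P with hPV
  have h1 : ∀ v : {v : V // 0 < PV v}, PV v *
      (testFamily hP hB hY hZ hcard s₀ y z).dist πX PW PWh π (some v) =
      PV v * ((PV v)⁻¹ * ∑ e : X × Y × Z, M (e.1, v.1, e.2.1, e.2.2) *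
        Real.log (M (e.1, v.1, e.2.1, e.2.2) / (PV v * π e))) := fun v => by
    rw [LetterFamily.dist, Finset.mul_sum, mul_inv_cancel_left₀ v.2.ne']
    refine Finset.sum_congr rfl fun e _ => ?_
    rw [hM, marg_bJoint_obs hX hW hWh hP hB hY hZ hcard s₀ y z v e,
      mul_div_mul_left _ _ v.2.ne', mul_assoc]
  refine (Finset.sum_congr rfl fun v _ => h1 v).trans ?_
  rw [sum_subtype_pos (marg_nonneg _ hP.1) fun v => (PV v)⁻¹ * ∑ e : X × Y × Z,
    M (e.1, v, e.2.1, e.2.2) * Real.log (M (e.1, v, e.2.1, e.2.2) / (PV v * π e))]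
  simp only [Fintype.sum_prod_type]
  rw [Finset.sum_comm]
  refine Finset.sum_congr rfl fun v _ => ?_
  simp only [hPV]
  by_cases hv : marg (fun p : U × Uh × V => p.2.2) P v = 0
  · simp only [hv, zero_mul, div_zero, Real.log_zero, mul_zero, Finset.sum_const_zero]
  · rw [mul_inv_cancel_left₀ hv]

end

end Feasible

section Achievability

variable {U Uh V W Wh X Y Z B : Type} [Fintype U] [Fintype Uh] [Fintype V] [Fintype W]
  [Fintype Wh] [Fintype X] [Fintype Y] [Fintype Z] [Fintype B]
  {πX : X → ℝ} {PW : W → ℝ} {PWh : Wh → ℝ} {P : U × Uh × V → ℝ} {PB : X × U × Uh × V → B → ℝ}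
  {PY : B × U × Uh × V → Y → ℝ} {PZ : B × U × V → Z → ℝ}

section

variable (hX : IsDist πX) (hW : IsDist PW) (hWh : IsDist PWh) (hP : IsDist P) (hB : IsKernel PB)
  (hY : IsKernel PY) (hZ : IsKernel PZ) (hcard : 2 ≤ Fintype.card B) (s₀ : U × Uh) (y : Y) (z : Z)

include hW hWh in
lemma obs_testFamily_none :
    (testFamily hP hB hY hZ hcard s₀ y z).obs πX PW PWh none =
      fun e => πX e.1 * (ind y e.2.1 * ind z e.2.2) := by
  rw [LetterFamily.obs_eq_marg_core hW hWh, core_testFamily_none]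
  funext e
  rw [marg_snd]
  dsimp only
  rw [← Finset.sum_mul, (LetterFamily.isDist_key_source (isDist_uniform hcard) (isDist_ind s₀)).2,
    one_mul]

include hX hW hWh in
lemma gap₁_testFamily_none :
    (testFamily hP hB hY hZ hcard s₀ y z).gap₁ πX PW PWh none =
      ent PW + ent (fun _ : B => (Fintype.card B : ℝ)⁻¹) := by
  have h1 := marg_mul (fun c : B × (U × Uh) => (c.1, c.2.1)) (fun e : X × Y × Z => e)
    (fun c => (Fintype.card B : ℝ)⁻¹ * ind s₀ c.2) fun e => πX e.1 * (ind y e.2.1 * ind z e.2.2)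
  have h2 := marg_mul (fun b : B => b) (Prod.fst : U × Uh → U)
    (fun _ => (Fintype.card B : ℝ)⁻¹) (ind s₀)
  rw [LetterFamily.gap₁_eq hX hW hWh, ← LetterFamily.obs_eq_marg_core hW hWh,
    obs_testFamily_none hW hWh, core_testFamily_none, h1, h2, marg_id, marg_id,
    ent_mul (LetterFamily.isDist_key_source (isDist_uniform hcard) (isDist_marg _ (isDist_ind s₀)))
      (isDist_ind_source y z hX),
    ent_mul (isDist_uniform hcard) (isDist_marg _ (isDist_ind s₀))]
  have h3 : (testFamily hP hB hY hZ hcard s₀ y z).key none = ind s₀ := rfl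
  rw [h3]
  ring

include hX hW hWh in
lemma gap₂_testFamily_none :
    (testFamily hP hB hY hZ hcard s₀ y z).gap₂ πX PW PWh none =
      ent PW + ent PWh + ent (fun _ : B => (Fintype.card B : ℝ)⁻¹) := by
  rw [LetterFamily.gap₂_eq hX hW hWh, ← LetterFamily.obs_eq_marg_core hW hWh,
    obs_testFamily_none hW hWh, core_testFamily_none,
    ent_mul (LetterFamily.isDist_key_source (isDist_uniform hcard) (isDist_ind s₀))
      (isDist_ind_source y z hX),
    ent_mul (isDist_uniform hcard) (isDist_ind s₀)]
  have h3 : (testFamily hP hB hY hZ hcard s₀ y z).key none = ind s₀ := rfl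
  rw [h3]
  ring

end

/-- A single-letter scheme meeting both key budgets bounds the limiting divergence. -/
lemma limit_le_of_feasible {π : X × Y × Z → ℝ} (hπ : IsDist π) (hW : IsDist PW) (hWh : IsDist PWh)
    (hP : IsDist P) (hB : IsKernel PB) (hY : IsKernel PY) (hZ : IsKernel PZ)
    (hcard : 2 ≤ Fintype.card B)
    (hyz : ∃ y : Y, ∃ z : Z, ∀ x : X,
      0 < marg (fun q : X × Y × Z => q.1) π x → 0 < π (x, y, z))
    (hπX : πX = marg (fun q : X × Y × Z => q.1) π)
    (h₁ : condEnt (fun q => q.2.1) (fun q => q.2.2.2.1) (bJoint πX P PB PY PZ) ≤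
      ent PW + condEnt (fun q => (q.2.2.2.2.1, q.2.1))
        (fun q => (q.1, q.2.2.2.2.2.1, q.2.2.2.2.2.2, q.2.2.2.1)) (bJoint πX P PB PY PZ))
    (h₂ : condEnt (fun q => (q.2.1, q.2.2.1)) (fun q => q.2.2.2.1) (bJoint πX P PB PY PZ) ≤
      ent PWh + ent PW + condEnt (fun q => (q.2.2.2.2.1, q.2.1, q.2.2.1))
        (fun q => (q.1, q.2.2.2.2.2.1, q.2.2.2.2.2.2, q.2.2.2.1)) (bJoint πX P PB PY PZ))
    {G : ℝ≥0∞}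
    (hG : Filter.Tendsto (fun n : ℕ => BGammaN W Wh X Y Z B PW PWh π n / (n : ℝ≥0∞))
      Filter.atTop (nhds G)) :
    G ≤ KL (marg (fun q => (q.1, q.2.2.2.1, q.2.2.2.2.2.1, q.2.2.2.2.2.2)) (bJoint πX P PB PY PZ))
      (fun r : X × V × Y × Z =>
        marg (fun p : U × Uh × V => p.2.2) P r.2.1 * π (r.1, r.2.2.1, r.2.2.2)) := by
  rw [KL]
  split_ifs with hac
  swap
  · exact le_top
  have hX : IsDist πX := hπX ▸ isDist_marg _ hπ
  obtain ⟨y, z, hyz⟩ := hyz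
  have hne : Nonempty (U × Uh × V) := by
    by_contra hne
    rw [not_nonempty_iff] at hne
    simpa using hP.2
  obtain ⟨u, uh, -⟩ := hne
  set L := testFamily hP hB hY hZ hcard (u, uh) y z with hL
  rw [← sum_dist_testFamily hX hW hWh hP hB hY hZ hcard (u, uh) y z π, ← hL]
  set D := ∑ v : {v : V // 0 < marg (fun p : U × Uh × V => p.2.2) P v},
    marg (fun p : U × Uh × V => p.2.2) P v * L.dist πX PW PWh π (some v) with hD
  have hun := ent_uniform_pos hcard
  have hW0 := ent_nonneg hW
  have hWh0 := ent_nonneg hWh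
  have hgap₁ := gap₁_testFamily_none hX hW hWh hP hB hY hZ hcard (u, uh) y z
  have hgap₂ := gap₂_testFamily_none hX hW hWh hP hB hY hZ hcard (u, uh) y z
  have hsum₁ := sum_gap₁_testFamily hX hW hWh hP hB hY hZ hcard (u, uh) y z
  have hsum₂ := sum_gap₂_testFamily hX hW hWh hP hB hY hZ hcard (u, uh) y z
  rw [← hL] at hgap₁ hgap₂ hsum₁ hsum₂
  have key : ∀ t : ℝ, D < t → G ≤ ENNReal.ofReal t := by
    intro t ht
    obtain ⟨δ, hδ, hδt⟩ : ∃ δ > 0, δ * (L.dist πX PW PWh π none - t) < t - D := by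
      refine ⟨(t - D) / (|L.dist πX PW PWh π none - t| + 1), by
        have := sub_pos.2 ht; positivity, ?_⟩
      rw [div_mul_eq_mul_div, div_lt_iff₀ (by positivity)]
      have := le_abs_self (L.dist πX PW PWh π none - t)
      nlinarith
    subst hπX
    refine limit_le_of_family (L := L) hX hW hWh ?_ (i₀ := none) (s₀ := (u, uh)) (fun s => rfl)
      (q := fun i => i.elim δ fun v => marg (fun p : U × Uh × V => p.2.2) P v) ?_
      ?_ ?_ ?_ ?_ ?_ hG
    · rintro (_ | v) e he
      · rw [hL, obs_testFamily_none hW hWh]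
        obtain ⟨x, y', z'⟩ := e
        by_contra hx
        have h1 := left_ne_zero_of_mul hx
        have h2 := left_ne_zero_of_mul (right_ne_zero_of_mul hx)
        have h3 := right_ne_zero_of_mul (right_ne_zero_of_mul hx)
        simp only [ind, ne_eq, ite_eq_right_iff, one_ne_zero, imp_false, not_not] at h2 h3
        subst h2 h3
        exact (hyz x (lt_of_le_of_ne (hX.1 x) (Ne.symm h1))).ne' he
      · have h1 := hac (e.1, v.1, e.2.1, e.2.2) (by
          simp only [Prod.mk.eta, he, mul_zero])
        rw [marg_bJoint_obs hX hW hWh hP hB hY hZ hcard (u, uh) y z v e] at h1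
        exact (mul_eq_zero.1 h1).resolve_left v.2.ne'
    · rintro (_ | v)
      · exact hδ.le
      · exact v.2.le
    · rw [Fintype.sum_option]
      simp only [Option.elim_none, Option.elim_some]
      rw [hsum₁, hgap₁]
      have := mul_pos hδ (add_pos_of_nonneg_of_pos hW0 hun)
      linarith
    · rw [Fintype.sum_option]
      simp only [Option.elim_none, Option.elim_some]
      rw [hsum₂, hgap₂]
      have := mul_pos hδ (add_pos_of_nonneg_of_pos (add_nonneg hW0 hWh0) hun)
      linarith
    · rw [Fintype.sum_option]
      simp only [Option.elim_none, Option.elim_some, mul_sub, Finset.sum_sub_distrib,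
        ← Finset.sum_mul, sum_subtype_marg hP]
      rw [← hD]
      linarith
    · rw [hgap₁]
      have := ent_nonneg (isDist_marg Prod.fst (L.key_dist none))
      linarith
    · rw [hgap₂]
      have := ent_nonneg (L.key_dist none)
      linarith
  have hlim : Filter.Tendsto (fun t => ENNReal.ofReal t) (nhdsWithin D (Set.Ioi D))
      (nhds (ENNReal.ofReal D)) :=
    (ENNReal.continuous_ofReal.tendsto D).mono_left nhdsWithin_le_nhds
  exact ge_of_tendsto hlim (Filter.eventually_of_mem self_mem_nhdsWithin fun t ht => key t ht)

end Achievability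

/-- broadcast upper bound: if `Γ(π_{XYZ}, P_W P_Ŵ)` is the limit of
the normalized least divergences, then `Γ ≤ Δ̂(π_{XYZ}, P_W P_Ŵ)`, where `Δ̂` has
the extra term `I(B;Û|XYZUV)` added to the left side of the first constraint. -/
theorem broadcast_sequential_synthesis_upper_bound
    (W Wh X Y Z B : Type) [Fintype W] [Fintype Wh] [Fintype X]
    [Fintype Y] [Fintype Z] [Fintype B]
    (PW : W → ℝ) (hPW : IsDist PW) (PWh : Wh → ℝ) (hPWh : IsDist PWh)
    (π : X × Y × Z → ℝ) (hπ : IsDist π)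
    (hB : 2 ≤ Fintype.card B)
    (hyz : ∃ y : Y, ∃ z : Z, ∀ x : X,
      0 < marg (fun q : X × Y × Z => q.1) π x → 0 < π (x, y, z))
    (G : ℝ≥0∞)
    (hG : Filter.Tendsto (fun n : ℕ => BGammaN W Wh X Y Z B PW PWh π n / (n : ℝ≥0∞))
      Filter.atTop (nhds G)) :
    G ≤ sInf (bDeltaSet X Y Z B π (ent PW) (ent PWh) true) := by
  refine le_sInf ?_
  rintro d ⟨m, mh, l, P, PB, PY, PZ, hP, hPB, hPY, hPZ, h₁, h₂, rfl⟩
  refine limit_le_of_feasible hπ hPW hPWh hP hPB hPY hPZ hB hyz rfl ?_ h₂ hG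
  rw [if_pos rfl] at h₁
  exact (le_add_of_nonneg_right (condMI_nonneg _ _ _
    (isDist_bJoint (isDist_marg _ hπ) hP hPB hPY hPZ))).trans h₁

end
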